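/- arXiv:1407.7453 — 11 statements merged into one kernel-verified Lean document; each statement's English description precedes it below -/
import Mathlib

section
/- Let (b,c) be a connected graph over (X,m) and let F₀ ⊆ F be a linear subspace which is closed under pointwise maximum and pointwise minimum (a Riesz space of functions). If F₀ contains no non-constant positive subharmonic function, then for every λ ≤ 0 every solution f ∈ F₀ of 𝓛f = λf is constant; in particular, for every λ < 0 every solution f ∈ F₀ of 𝓛f = λf is identically zero. -/
/-!
STATEMENT 0: If a Riesz space `F₀ ⊆ F` contains no non-constant positive subharmonic
function, then every solution in `F₀` for `λ ≤ 0` is constant, and every solution in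
`F₀` for `λ < 0` is identically zero.
-/

namespace Stmt0

/-- The formal Laplacian `𝓛 f (x) = (1/m x) ∑_y b x y (f x - f y) + (c x / m x) f x`. -/
noncomputable def lap {X : Type*} (m : X → ℝ) (b : X → X → ℝ) (c : X → ℝ)
    (f : X → ℝ) (x : X) : ℝ :=
  (1 / m x) * (∑' y, b x y * (f x - f y)) + (c x / m x) * f x

/-- Membership in the generalized form domain `F`. -/
def memF {X : Type*} (b : X → X → ℝ) (f : X → ℝ) : Prop :=
  ∀ x, Summable fun y => b x y * (f y) ^ 2

theorem memF.summable_mul {X : Type*} {b : X → X → ℝ} {f : X → ℝ}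
    (hb_nonneg : ∀ x y, 0 ≤ b x y) (hb_sum : ∀ x, Summable fun y => b x y)
    (hf : memF b f) (x : X) : Summable fun y => b x y * f y := by
  refine Summable.of_norm_bounded ((hb_sum x).add (hf x)) fun y => ?_
  rw [Real.norm_eq_abs, abs_mul, abs_of_nonneg (hb_nonneg x y), ← mul_one_add]
  refine mul_le_mul_of_nonneg_left ?_ (hb_nonneg x y)
  nlinarith [sq_nonneg (|f y| - 1), sq_abs (f y)]

theorem memF.summable_mul_sub {X : Type*} {b : X → X → ℝ} {f : X → ℝ}
    (hb_nonneg : ∀ x y, 0 ≤ b x y) (hb_sum : ∀ x, Summable fun y => b x y)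
    (hf : memF b f) (x : X) : Summable fun y => b x y * (f x - f y) := by
  simpa only [mul_sub] using
    ((hb_sum x).mul_right (f x)).sub (hf.summable_mul hb_nonneg hb_sum x)

/-- The positive part of a solution for `lam ≤ 0` is subharmonic. -/
theorem lap_sup_zero_nonpos {X : Type*} {m : X → ℝ} {b : X → X → ℝ} {c : X → ℝ}
    {f : X → ℝ} {lam : ℝ} (hm : ∀ x, 0 < m x) (hb_nonneg : ∀ x y, 0 ≤ b x y)
    (hb_sum : ∀ x, Summable fun y => b x y) (hf : memF b f) (hf' : memF b (f ⊔ 0))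
    (hlam : lam ≤ 0) (hsol : ∀ x, lap m b c f x = lam * f x) (x : X) :
    lap m b c (f ⊔ 0) x ≤ 0 := by
  have hm' : 0 ≤ 1 / m x := (one_div_pos.mpr (hm x)).le
  rcases le_total (f x) 0 with hx | hx
  · have hx' : (f ⊔ 0) x = 0 := sup_eq_right.mpr hx
    unfold lap
    rw [hx', mul_zero, add_zero]
    refine mul_nonpos_of_nonneg_of_nonpos hm' (tsum_nonpos fun y => ?_)
    refine mul_nonpos_of_nonneg_of_nonpos (hb_nonneg x y) ?_
    rw [zero_sub]
    exact neg_nonpos.mpr le_sup_right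
  · have hx' : (f ⊔ 0) x = f x := sup_eq_left.mpr hx
    have hle : lap m b c (f ⊔ 0) x ≤ lap m b c f x := by
      have hs := hf'.summable_mul_sub hb_nonneg hb_sum x
      unfold lap
      rw [hx'] at hs ⊢
      refine add_le_add (mul_le_mul_of_nonneg_left ?_ hm') le_rfl
      refine hs.tsum_le_tsum (fun y => ?_) (hf.summable_mul_sub hb_nonneg hb_sum x)
      exact mul_le_mul_of_nonneg_left (sub_le_sub_left le_sup_left _) (hb_nonneg x y)
    exact (hle.trans_eq (hsol x)).trans (mul_nonpos_of_nonpos_of_nonneg hlam hx)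

theorem lap_neg {X : Type*} (m : X → ℝ) (b : X → X → ℝ) (c f : X → ℝ) (x : X) :
    lap m b c (-f) x = -lap m b c f x := by
  have h : (fun y => b x y * ((-f) x - (-f) y)) = fun y => -(b x y * (f x - f y)) := by
    ext y
    simp only [Pi.neg_apply]
    ring
  unfold lap
  rw [h, tsum_neg, Pi.neg_apply]
  ring

theorem lap_of_eq_const {X : Type*} (m : X → ℝ) (b : X → X → ℝ) (c : X → ℝ) {f : X → ℝ}
    {a : ℝ} (hf : ∀ x, f x = a) (x : X) : lap m b c f x = c x / m x * a := by
  simp [lap, hf]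

theorem liouville_from_no_positive_subharmonic
    {X : Type*} [Countable X] [Infinite X]
    (m : X → ℝ) (hm : ∀ x, 0 < m x)
    (b : X → X → ℝ) (hb_symm : ∀ x y, b x y = b y x)
    (hb_nonneg : ∀ x y, 0 ≤ b x y) (hb_diag : ∀ x, b x x = 0)
    (hb_sum : ∀ x, Summable fun y => b x y)
    (c : X → ℝ) (hc : ∀ x, 0 ≤ c x)
    (hconn : ∀ x y : X, Relation.ReflTransGen (fun u v : X => 0 < b u v) x y)
    -- F₀ is a Riesz space of functions contained in F:
    (F₀ : Set (X → ℝ))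
    (hF₀F : ∀ f ∈ F₀, memF b f)
    (hzero : (0 : X → ℝ) ∈ F₀)
    (hadd : ∀ f ∈ F₀, ∀ g ∈ F₀, f + g ∈ F₀)
    (hsmul : ∀ (a : ℝ) (f : X → ℝ), f ∈ F₀ → a • f ∈ F₀)
    (hmax : ∀ f ∈ F₀, ∀ g ∈ F₀, f ⊔ g ∈ F₀)
    (hmin : ∀ f ∈ F₀, ∀ g ∈ F₀, f ⊓ g ∈ F₀)
    -- no non-constant positive subharmonic functions in F₀:
    (hLiouville : ∀ f ∈ F₀, (∀ x, 0 ≤ f x) → f ≠ 0 →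
      (∀ x, lap m b c f x ≤ 0) → ∃ a : ℝ, ∀ x, f x = a) :
    (∀ lam : ℝ, lam ≤ 0 → ∀ f ∈ F₀, (∀ x, lap m b c f x = lam * f x) →
        ∃ a : ℝ, ∀ x, f x = a) ∧
    (∀ lam : ℝ, lam < 0 → ∀ f ∈ F₀, (∀ x, lap m b c f x = lam * f x) →
        ∀ x, f x = 0) := by
  have hconst : ∀ lam : ℝ, lam ≤ 0 → ∀ f ∈ F₀, (∀ x, lap m b c f x = lam * f x) →
      ∃ a : ℝ, ∀ x, f x = a := by
    have hpos : ∀ lam : ℝ, lam ≤ 0 → ∀ f ∈ F₀, (∀ x, lap m b c f x = lam * f x) →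
        ∃ a : ℝ, ∀ x, (f ⊔ 0) x = a := by
      intro lam hlam f hf hsol
      have hf' := hmax f hf 0 hzero
      by_cases h0 : f ⊔ 0 = 0
      · exact ⟨0, fun x => congrFun h0 x⟩
      · exact hLiouville _ hf' (fun x => le_sup_right) h0
          (lap_sup_zero_nonpos hm hb_nonneg hb_sum (hF₀F f hf) (hF₀F _ hf') hlam hsol)
    intro lam hlam f hf hsol
    have hneg : -f ∈ F₀ := by simpa using hsmul (-1) f hf
    obtain ⟨p, hp⟩ := hpos lam hlam f hf hsol
    obtain ⟨q, hq⟩ := hpos lam hlam (-f) hneg fun x => by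
      rw [lap_neg, hsol x, Pi.neg_apply, mul_neg]
    refine ⟨p - q, fun x => ?_⟩
    rw [← hp x, ← hq x]
    exact (posPart_sub_negPart (f x)).symm
  refine ⟨hconst, fun lam hlam f hf hsol x => ?_⟩
  obtain ⟨a, ha⟩ := hconst lam hlam.le f hf hsol
  have h := hsol x
  rw [lap_of_eq_const m b c ha, ha x] at h
  have hcm : 0 ≤ c x / m x := div_nonneg (hc x) (hm x).le
  rw [ha x]
  exact (mul_eq_mul_right_iff.mp h).resolve_left (by linarith)

end Stmt0
end

section
/- Let (b,c) be a graph over (X,m), let f ∈ F and let φ : X → ℝ be finitely supported. Then all of the following sums converge absolutely and (1/2) ∑_{x,y∈X} b(x,y)(f(x)−f(y))(φ(x)−φ(y)) + ∑_{x∈X} c(x) f(x) φ(x) = ∑_{x∈X} (𝓛f)(x) φ(x) m(x) = ∑_{x∈X} f(x) (𝓛φ)(x) m(x) (Green's formula; note that every finitely supported function belongs to F). -/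
/-!
STATEMENT 1: Green's formula. For `f ∈ F` and finitely supported `φ`, all sums converge
absolutely and
`(1/2) ∑_{x,y} b(x,y)(f x - f y)(φ x - φ y) + ∑_x c x * f x * φ x
   = ∑_x (𝓛f)(x) φ(x) m(x) = ∑_x f(x) (𝓛φ)(x) m(x)`.
-/

namespace Stmt1

/-- The formal Laplacian `𝓛 f (x) = (1/m x) ∑_y b x y (f x - f y) + (c x / m x) f x`. -/
noncomputable def lap {X : Type*} (m : X → ℝ) (b : X → X → ℝ) (c : X → ℝ)
    (f : X → ℝ) (x : X) : ℝ :=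
  (1 / m x) * (∑' y, b x y * (f x - f y)) + (c x / m x) * f x

theorem hasSum_congr_of_forall_eq {ι : Type*} {f g : ι → ℝ} {a : ℝ} (h : ∀ i, f i = g i) :
    HasSum f a ↔ HasSum g a := by
  rw [funext h]

theorem hasSum_prod_swap {α : Type*} {g : α × α → ℝ} {a : ℝ} (hg : HasSum g a) :
    HasSum (fun p : α × α => g (p.2, p.1)) a :=
  (Equiv.prodComm α α).hasSum_iff.mpr hg

theorem summable_mul_of_summable_mul_sq {ι : Type*} {w f : ι → ℝ} (hw : ∀ i, 0 ≤ w i)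
    (hw_sum : Summable w) (hf : Summable fun i => w i * f i ^ 2) :
    Summable fun i => w i * f i := by
  refine Summable.of_norm_bounded (hw_sum.add hf) fun i => ?_
  rw [Real.norm_eq_abs, abs_mul, abs_of_nonneg (hw i)]
  nlinarith [hw i, mul_nonneg (hw i) (sq_nonneg (|f i| - 1)), sq_abs (f i),
    mul_nonneg (hw i) (abs_nonneg (f i))]

theorem summable_prod_of_finite_rows {α β : Type*} {g : α × β → ℝ} {s : Set α} (hs : s.Finite)
    (hzero : ∀ a ∉ s, ∀ b, g (a, b) = 0) (hrow : ∀ a, Summable fun b => g (a, b)) :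
    Summable g := by
  rw [← summable_abs_iff, summable_prod_of_nonneg fun p => abs_nonneg (g p)]
  refine ⟨fun a => (hrow a).abs, summable_of_ne_finset_zero (s := hs.toFinset) fun a ha => ?_⟩
  rw [Set.Finite.mem_toFinset] at ha
  simp [hzero a ha]

theorem lap_mul_measure {X : Type*} {m : X → ℝ} (b : X → X → ℝ) (c f : X → ℝ) {x : X}
    (hm : m x ≠ 0) :
    lap m b c f x * m x = (∑' y, b x y * (f x - f y)) + c x * f x := by
  unfold lap
  field_simp

theorem greens_formula
    {X : Type*} [Countable X] [Infinite X]
    (m : X → ℝ) (hm : ∀ x, 0 < m x)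
    (b : X → X → ℝ) (hb_symm : ∀ x y, b x y = b y x)
    (hb_nonneg : ∀ x y, 0 ≤ b x y) (hb_diag : ∀ x, b x x = 0)
    (hb_sum : ∀ x, Summable fun y => b x y)
    (c : X → ℝ) (hc : ∀ x, 0 ≤ c x)
    (f : X → ℝ) (hf : ∀ x, Summable fun y => b x y * (f y) ^ 2)
    (φ : X → ℝ) (hφ : (Function.support φ).Finite) :
    Summable (fun p : X × X => b p.1 p.2 * (f p.1 - f p.2) * (φ p.1 - φ p.2)) ∧
    Summable (fun x => c x * f x * φ x) ∧
    Summable (fun x => lap m b c f x * φ x * m x) ∧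
    Summable (fun x => f x * lap m b c φ x * m x) ∧
    (1 / 2) * (∑' p : X × X, b p.1 p.2 * (f p.1 - f p.2) * (φ p.1 - φ p.2))
        + ∑' x, c x * f x * φ x
      = ∑' x, lap m b c f x * φ x * m x ∧
    (1 / 2) * (∑' p : X × X, b p.1 p.2 * (f p.1 - f p.2) * (φ p.1 - φ p.2))
        + ∑' x, c x * f x * φ x
      = ∑' x, f x * lap m b c φ x * m x := by
  have hbf (x : X) : Summable fun y => b x y * f y :=
    summable_mul_of_summable_mul_sq (hb_nonneg x) (hb_sum x) (hf x)
  have hφ_zero (x : X) (hx : x ∉ Function.support φ) : φ x = 0 := Function.notMem_support.mp hx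
  have hH : Summable fun p : X × X => b p.1 p.2 * (f p.1 * φ p.1) :=
    summable_prod_of_finite_rows hφ (fun x hx y => by simp [hφ_zero x hx])
      fun x => (hb_sum x).mul_right (f x * φ x)
  have hK : Summable fun p : X × X => b p.1 p.2 * f p.2 * φ p.1 :=
    summable_prod_of_finite_rows hφ (fun x hx y => by simp [hφ_zero x hx])
      fun x => (hbf x).mul_right (φ x)
  have hG : HasSum (fun p : X × X => φ p.1 * (b p.1 p.2 * (f p.1 - f p.2)))
      ((∑' p : X × X, b p.1 p.2 * (f p.1 * φ p.1)) - ∑' p : X × X, b p.1 p.2 * f p.2 * φ p.1) := by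
    refine (hasSum_congr_of_forall_eq fun p => ?_).mpr (hH.hasSum.sub hK.hasSum)
    ring
  have hE : HasSum (fun p : X × X => b p.1 p.2 * (f p.1 - f p.2) * (φ p.1 - φ p.2))
      (((∑' p : X × X, b p.1 p.2 * (f p.1 * φ p.1)) - ∑' p : X × X, b p.1 p.2 * f p.2 * φ p.1) +
        ((∑' p : X × X, b p.1 p.2 * (f p.1 * φ p.1)) -
          ∑' p : X × X, b p.1 p.2 * f p.2 * φ p.1)) := by
    refine (hasSum_congr_of_forall_eq fun p => ?_).mpr (hG.add (hasSum_prod_swap hG))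
    simp only [hb_symm p.2 p.1]
    ring
  have hL : HasSum (fun p : X × X => f p.1 * (b p.1 p.2 * (φ p.1 - φ p.2)))
      ((∑' p : X × X, b p.1 p.2 * (f p.1 * φ p.1)) - ∑' p : X × X, b p.1 p.2 * f p.2 * φ p.1) := by
    refine (hasSum_congr_of_forall_eq fun p => ?_).mpr (hH.hasSum.sub (hasSum_prod_swap hK.hasSum))
    simp only [hb_symm p.2 p.1]
    ring
  have hc_sum : Summable fun x => c x * f x * φ x :=
    summable_of_ne_finset_zero (s := hφ.toFinset) fun x hx => by
      rw [Set.Finite.mem_toFinset] at hx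
      simp [hφ_zero x hx]
  have hlap_f : HasSum (fun x => lap m b c f x * φ x * m x)
      ((∑' (x : X) (y : X), φ x * (b x y * (f x - f y))) + ∑' x, c x * f x * φ x) := by
    refine (hasSum_congr_of_forall_eq fun x => ?_).mpr (hG.summable.prod.hasSum.add hc_sum.hasSum)
    rw [mul_right_comm, lap_mul_measure b c f (hm x).ne']
    dsimp only
    rw [tsum_mul_left]
    ring
  have hlap_φ : HasSum (fun x => f x * lap m b c φ x * m x)
      ((∑' (x : X) (y : X), f x * (b x y * (φ x - φ y))) + ∑' x, c x * f x * φ x) := by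
    refine (hasSum_congr_of_forall_eq fun x => ?_).mpr (hL.summable.prod.hasSum.add hc_sum.hasSum)
    rw [mul_assoc, lap_mul_measure b c φ (hm x).ne']
    dsimp only
    rw [tsum_mul_left]
    ring
  refine ⟨hE.summable, hc_sum, hlap_f.summable, hlap_φ.summable, ?_, ?_⟩
  · rw [hlap_f.tsum_eq, ← hG.summable.tsum_prod, hG.tsum_eq, hE.tsum_eq]
    ring
  · rw [hlap_φ.tsum_eq, ← hL.summable.tsum_prod, hL.tsum_eq, hE.tsum_eq]
    ring

end Stmt1
end

section
/- Let (b,c) be a graph over (X,m). The following are equivalent: (i) the function x ↦ (1/m(x))(∑_{y∈X} b(x,y) + c(x)) is bounded on X; (ii) there exists C ≥ 0 such that 𝒬(f) ≤ C ‖f‖₂² for every f ∈ ℓ²(X,m). Moreover, if the function in (i) is bounded by D < ∞, then 𝒬(f) ≤ 2D ‖f‖₂² for every f ∈ ℓ²(X,m). -/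
/-!
STATEMENT 2: Boundedness of the form. (i) `x ↦ (1/m x)(∑_y b x y + c x)` is bounded
iff (ii) there is `C ≥ 0` with `𝒬(f) ≤ C ‖f‖₂²` for all `f ∈ ℓ²(X,m)`.
Moreover a bound `D` in (i) yields `𝒬(f) ≤ 2D ‖f‖₂²`.

To accommodate the value `+∞` the form `𝒬` is taken with values in `ℝ≥0∞`; this also
makes the restriction to `f ∈ ℓ²(X,m)` automatic (for `f ∉ ℓ²` the right hand side
is `∞`).
-/

open scoped ENNReal

namespace Stmt2

/-- The quadratic form `𝒬(f) ∈ [0,∞]`. -/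
noncomputable def Qform {X : Type*} (b : X → X → ℝ) (c : X → ℝ) (f : X → ℝ) : ℝ≥0∞ :=
  (1 / 2 : ℝ≥0∞) * (∑' p : X × X, ENNReal.ofReal (b p.1 p.2 * (f p.1 - f p.2) ^ 2))
    + ∑' x, ENNReal.ofReal (c x * (f x) ^ 2)

/-- `‖f‖₂² ∈ [0,∞]`. -/
noncomputable def normSq {X : Type*} (m : X → ℝ) (f : X → ℝ) : ℝ≥0∞ :=
  ∑' x, ENNReal.ofReal ((f x) ^ 2 * m x)

/-- The weighted degree `∑_y b x y` with values in `ℝ≥0∞`. -/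
noncomputable def edeg {X : Type*} (b : X → X → ℝ) (x : X) : ℝ≥0∞ :=
  ∑' y, ENNReal.ofReal (b x y)

lemma edeg_eq_ofReal {X : Type*} {b : X → X → ℝ} (hb : ∀ x y, 0 ≤ b x y) {x : X}
    (hs : Summable fun y => b x y) : edeg b x = ENNReal.ofReal (∑' y, b x y) :=
  (ENNReal.ofReal_tsum_of_nonneg (hb x) hs).symm

/-- Summing a symmetrised weight over all pairs gives twice the degree sum. -/
lemma tsum_prod_symm_weight {X : Type*} {b : X → X → ℝ} (hb_symm : ∀ x y, b x y = b y x)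
    (g : X → ℝ≥0∞) :
    ∑' p : X × X, (ENNReal.ofReal (b p.1 p.2) * g p.1 + ENNReal.ofReal (b p.1 p.2) * g p.2) =
      2 * ∑' x, edeg b x * g x := by
  have h1 : ∑' p : X × X, ENNReal.ofReal (b p.1 p.2) * g p.1 = ∑' x, edeg b x * g x := by
    rw [ENNReal.tsum_prod']
    exact tsum_congr fun x => by simp only [edeg, ENNReal.tsum_mul_right]
  have h2 : ∑' p : X × X, ENNReal.ofReal (b p.1 p.2) * g p.2 = ∑' x, edeg b x * g x := by
    rw [← h1, ← (Equiv.prodComm X X).tsum_eq]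
    exact tsum_congr fun p => by simp [hb_symm p.2 p.1]
  rw [ENNReal.tsum_add, h1, h2, two_mul]

lemma half_mul_two_mul (a : ℝ≥0∞) : (1 / 2 : ℝ≥0∞) * (2 * a) = a := by
  rw [← mul_assoc, one_div, ENNReal.inv_mul_cancel two_ne_zero ENNReal.ofNat_ne_top, one_mul]

lemma Qform_le {X : Type*} {b : X → X → ℝ} (hb_symm : ∀ x y, b x y = b y x)
    (hb_nonneg : ∀ x y, 0 ≤ b x y) {c : X → ℝ} (hc : ∀ x, 0 ≤ c x) (f : X → ℝ) :
    Qform b c f ≤ ∑' x, 2 * (edeg b x + ENNReal.ofReal (c x)) * ENNReal.ofReal (f x ^ 2) := by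
  have hpair : ∑' p : X × X, ENNReal.ofReal (b p.1 p.2 * (f p.1 - f p.2) ^ 2) ≤
      2 * ∑' x, edeg b x * ENNReal.ofReal (2 * f x ^ 2) := by
    rw [← tsum_prod_symm_weight hb_symm]
    refine ENNReal.tsum_le_tsum fun p => ?_
    have hp := hb_nonneg p.1 p.2
    rw [← ENNReal.ofReal_mul hp, ← ENNReal.ofReal_mul hp,
      ← ENNReal.ofReal_add (by positivity) (by positivity), ← mul_add]
    refine ENNReal.ofReal_le_ofReal (mul_le_mul_of_nonneg_left ?_ hp)
    nlinarith [sq_nonneg (f p.1 + f p.2)]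
  calc Qform b c f
      ≤ (1 / 2 : ℝ≥0∞) * (2 * ∑' x, edeg b x * ENNReal.ofReal (2 * f x ^ 2))
          + ∑' x, ENNReal.ofReal (c x * f x ^ 2) := by
        unfold Qform
        gcongr
    _ = ∑' x, (edeg b x * ENNReal.ofReal (2 * f x ^ 2) + ENNReal.ofReal (c x * f x ^ 2)) := by
        rw [half_mul_two_mul, ENNReal.tsum_add]
    _ ≤ _ := by
        refine ENNReal.tsum_le_tsum fun x => ?_
        rw [ENNReal.ofReal_mul zero_le_two, ENNReal.ofReal_mul (hc x), ENNReal.ofReal_ofNat,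
          mul_add, add_mul, ← mul_assoc, mul_comm (edeg b x) 2]
        gcongr
        exact le_mul_of_one_le_left zero_le one_le_two

open Classical in
lemma le_Qform_single {X : Type*} {b : X → X → ℝ} (hb_symm : ∀ x y, b x y = b y x)
    (hb_diag : ∀ x, b x x = 0) (c : X → ℝ) (x : X) :
    edeg b x + ENNReal.ofReal (c x) ≤ Qform b c (Pi.single x 1) := by
  have hpair : 2 * edeg b x ≤ ∑' p : X × X, ENNReal.ofReal
      (b p.1 p.2 * ((Pi.single x 1 : X → ℝ) p.1 - (Pi.single x 1 : X → ℝ) p.2) ^ 2) := by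
    have h := tsum_prod_symm_weight hb_symm (Pi.single x 1 : X → ℝ≥0∞)
    rw [tsum_eq_single x fun y hy => by simp [hy], Pi.single_eq_same, mul_one] at h
    rw [← h]
    refine ENNReal.tsum_le_tsum fun ⟨y, z⟩ => ?_
    by_cases hy : y = x <;> by_cases hz : z = x <;> simp [hy, hz, hb_diag]
  unfold Qform
  gcongr
  · rw [← half_mul_two_mul (edeg b x)]
    gcongr
  · refine le_trans ?_ (ENNReal.le_tsum x)
    simp

open Classical in
lemma normSq_single {X : Type*} (m : X → ℝ) (x : X) :
    normSq m (Pi.single x 1) = ENNReal.ofReal (m x) := by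
  unfold normSq
  rw [tsum_eq_single x fun y hy => by simp [hy]]
  simp

theorem boundedness_of_form
    {X : Type*} [Countable X] [Infinite X]
    (m : X → ℝ) (hm : ∀ x, 0 < m x)
    (b : X → X → ℝ) (hb_symm : ∀ x y, b x y = b y x)
    (hb_nonneg : ∀ x y, 0 ≤ b x y) (hb_diag : ∀ x, b x x = 0)
    (hb_sum : ∀ x, Summable fun y => b x y)
    (c : X → ℝ) (hc : ∀ x, 0 ≤ c x) :
    ((∃ D : ℝ, ∀ x, (1 / m x) * ((∑' y, b x y) + c x) ≤ D) ↔
      (∃ C : ℝ, 0 ≤ C ∧ ∀ f : X → ℝ,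
        Qform b c f ≤ ENNReal.ofReal C * normSq m f)) ∧
    (∀ D : ℝ, (∀ x, (1 / m x) * ((∑' y, b x y) + c x) ≤ D) →
      ∀ f : X → ℝ, Qform b c f ≤ ENNReal.ofReal (2 * D) * normSq m f) := by
  have hdeg : ∀ x, edeg b x + ENNReal.ofReal (c x) = ENNReal.ofReal ((∑' y, b x y) + c x) :=
    fun x => by
      rw [edeg_eq_ofReal hb_nonneg (hb_sum x),
        ENNReal.ofReal_add (tsum_nonneg (hb_nonneg x)) (hc x)]
  have upper : ∀ D : ℝ, (∀ x, (1 / m x) * ((∑' y, b x y) + c x) ≤ D) →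
      ∀ f : X → ℝ, Qform b c f ≤ ENNReal.ofReal (2 * D) * normSq m f := by
    intro D hD f
    refine (Qform_le hb_symm hb_nonneg hc f).trans ?_
    unfold normSq
    rw [← ENNReal.tsum_mul_left]
    refine ENNReal.tsum_le_tsum fun x => ?_
    have hx : (∑' y, b x y) + c x ≤ D * m x := by
      rw [← div_le_iff₀ (hm x), ← one_div_mul_eq_div]
      exact hD x
    rw [hdeg, ENNReal.ofReal_mul (sq_nonneg (f x)), ENNReal.ofReal_mul zero_le_two,
      ENNReal.ofReal_ofNat, mul_comm (ENNReal.ofReal (f x ^ 2)), ← mul_assoc,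
      mul_assoc 2 (ENNReal.ofReal D),
      ← ENNReal.ofReal_mul' (hm x).le]
    gcongr
  refine ⟨⟨fun ⟨D, hD⟩ => ⟨2 * max D 0, by positivity, upper _ fun x =>
    (hD x).trans (le_max_left _ _)⟩, fun ⟨C, hC, h⟩ => ⟨C, fun x => ?_⟩⟩, upper⟩
  classical
  have hx := (le_Qform_single hb_symm hb_diag c x).trans (h (Pi.single x 1))
  rw [hdeg, normSq_single, ← ENNReal.ofReal_mul hC,
    ENNReal.ofReal_le_ofReal_iff (mul_nonneg hC (hm x).le)] at hx
  rwa [one_div_mul_eq_div, div_le_iff₀ (hm x)]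

end Stmt2
end

section
/- Let (b,c) be a graph over (X,m). The following are equivalent: (i) for every finitely supported φ : X → ℝ, the function 𝓛φ belongs to ℓ²(X,m); (ii) for every x ∈ X, ∑_{y∈X} b(x,y)²/m(y) < ∞, i.e. the function y ↦ b(x,y)/m(y) belongs to ℓ²(X,m). -/
/-!
STATEMENT 3: `𝓛 φ ∈ ℓ²(X,m)` for every finitely supported `φ` iff for every `x` the
function `y ↦ b(x,y)/m(y)` belongs to `ℓ²(X,m)`.
-/

namespace Stmt3

/-- The formal Laplacian `𝓛 φ (x) = (1/m x) ∑_y b x y (φ x - φ y) + (c x / m x) φ x`. -/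
noncomputable def lap {X : Type*} (m : X → ℝ) (b : X → X → ℝ) (c : X → ℝ)
    (φ : X → ℝ) (x : X) : ℝ :=
  (1 / m x) * (∑' y, b x y * (φ x - φ y)) + (c x / m x) * φ x

/-- Off the support of `φ`, the Laplacian reduces to a finite sum over the support. -/
theorem lap_eq_neg_sum_of_eq_zero {X : Type*} (m : X → ℝ) {b : X → X → ℝ}
    (hb_symm : ∀ x y, b x y = b y x) (c : X → ℝ) {φ : X → ℝ} {S : Finset X}
    (hS : Function.support φ ⊆ S) {x : X} (hx : φ x = 0) :
    lap m b c φ x = -∑ y ∈ S, φ y * (b y x / m x) := by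
  have hsum : ∑' y, b x y * (φ x - φ y) = ∑ y ∈ S, b x y * (φ x - φ y) := by
    refine tsum_eq_sum fun y hy => ?_
    have hy0 : φ y = 0 := by
      by_contra h
      exact hy (hS h)
    simp [hx, hy0]
  rw [lap, hsum, hx, mul_zero, add_zero, Finset.mul_sum, ← Finset.sum_neg_distrib]
  refine Finset.sum_congr rfl fun y _ => ?_
  rw [hb_symm x y]
  ring

/-- If each `y ↦ b x y / m y` is square summable, so is `lap m b c φ` for `φ` of finite support. -/
theorem summable_lap_sq_mul {X : Type*} {m : X → ℝ} (hm : ∀ x, 0 < m x) {b : X → X → ℝ}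
    (hb_symm : ∀ x y, b x y = b y x) (c : X → ℝ)
    (h : ∀ x, Summable fun y => (b x y / m y) ^ 2 * m y)
    {φ : X → ℝ} (hφ : (Function.support φ).Finite) :
    Summable fun x => (lap m b c φ x) ^ 2 * m x := by
  have hS : Function.support φ ⊆ hφ.toFinset := by simp
  have hbound : Summable fun x => (hφ.toFinset.card : ℝ) *
      ∑ y ∈ hφ.toFinset, φ y ^ 2 * ((b y x / m x) ^ 2 * m x) :=
    (summable_sum fun y _ => (h y).mul_left _).mul_left _
  refine Summable.of_norm_bounded_eventually hbound ?_
  filter_upwards [hφ.compl_mem_cofinite] with x hx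
  rw [lap_eq_neg_sum_of_eq_zero m hb_symm c hS (Function.notMem_support.1 hx), neg_sq,
    Real.norm_of_nonneg (mul_nonneg (sq_nonneg _) (hm x).le)]
  calc (∑ y ∈ hφ.toFinset, φ y * (b y x / m x)) ^ 2 * m x
      ≤ (hφ.toFinset.card * ∑ y ∈ hφ.toFinset, (φ y * (b y x / m x)) ^ 2) * m x :=
        mul_le_mul_of_nonneg_right sq_sum_le_card_mul_sum_sq (hm x).le
    _ = hφ.toFinset.card * ∑ y ∈ hφ.toFinset, φ y ^ 2 * ((b y x / m x) ^ 2 * m x) := by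
        rw [mul_assoc, Finset.sum_mul]
        congr 1
        exact Finset.sum_congr rfl fun y _ => by ring

/-- If the Laplacian of the indicator of `x` is square summable, so is `y ↦ b x y / m y`. -/
theorem summable_div_sq_mul {X : Type*} [DecidableEq X] {m : X → ℝ} {b : X → X → ℝ}
    (hb_symm : ∀ x y, b x y = b y x) {c : X → ℝ} {x : X}
    (h : Summable fun y => (lap m b c (Pi.single x 1) y) ^ 2 * m y) :
    Summable fun y => (b x y / m y) ^ 2 * m y := by
  refine (summable_congr_cofinite ?_).1 h
  filter_upwards [(Set.finite_singleton x).compl_mem_cofinite] with y hy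
  have hS : Function.support (Pi.single x 1 : X → ℝ) ⊆ ({x} : Finset X) := by simp
  rw [lap_eq_neg_sum_of_eq_zero m hb_symm c hS (Pi.single_eq_of_ne hy 1)]
  simp

theorem compactly_supported_in_domain_iff
    {X : Type*} [Countable X] [Infinite X]
    (m : X → ℝ) (hm : ∀ x, 0 < m x)
    (b : X → X → ℝ) (hb_symm : ∀ x y, b x y = b y x)
    (hb_nonneg : ∀ x y, 0 ≤ b x y) (hb_diag : ∀ x, b x x = 0)
    (hb_sum : ∀ x, Summable fun y => b x y)
    (c : X → ℝ) (hc : ∀ x, 0 ≤ c x) :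
    (∀ φ : X → ℝ, (Function.support φ).Finite →
        Summable fun x => (lap m b c φ x) ^ 2 * m x) ↔
    (∀ x, Summable fun y => (b x y / m y) ^ 2 * m y) := by
  classical
  refine ⟨fun h x => summable_div_sq_mul hb_symm (h _ ?_),
    fun h φ hφ => summable_lap_sq_mul hm hb_symm c h hφ⟩
  exact (Set.finite_singleton x).subset (by simp)

end Stmt3
end

section
/- Let b be a connected graph over (X,m) and define the degree path metric ρ₀(x,y) = inf over all paths x = x₀ ∼ x₁ ∼ … ∼ x_n = y of ∑_{i=1}^n (max(Deg(x_{i−1}), Deg(x_i)))^{−1/2}, with ρ₀(x,x) = 0. Then ρ₀ is a pseudo metric on X and it is an intrinsic metric, i.e. ∑_{y∈X} b(x,y) ρ₀(x,y)² ≤ m(x) for every x ∈ X. -/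
/-!
STATEMENT 4: The degree path metric `ρ₀` is a pseudo metric and an intrinsic metric,
i.e. `∑_y b(x,y) ρ₀(x,y)² ≤ m(x)` for every `x`.
-/

open scoped ENNReal

namespace Stmt4

/-- The weighted vertex degree `Deg(x) = (1/m x) ∑_y b x y`. -/
noncomputable def Deg {X : Type*} (m : X → ℝ) (b : X → X → ℝ) (x : X) : ℝ :=
  (1 / m x) * ∑' y, b x y

/-- The degree path metric: the infimum over all paths `x = x₀ ∼ … ∼ x_n = y` of
`∑_{i=1}^n (max (Deg x_{i-1}) (Deg x_i))^{-1/2}`. -/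
noncomputable def rho0 {X : Type*} (m : X → ℝ) (b : X → X → ℝ) (x y : X) : ℝ :=
  sInf {s : ℝ | ∃ (n : ℕ) (γ : ℕ → X), γ 0 = x ∧ γ n = y ∧
    (∀ i < n, 0 < b (γ i) (γ (i + 1))) ∧
    s = ∑ i ∈ Finset.range n,
      (Real.sqrt (max (Deg m b (γ i)) (Deg m b (γ (i + 1)))))⁻¹}

/-- The lengths of all finite `r`-paths from `x` to `y`, where the edge `(u, v)` has length
`w u v`. -/
def pathLengths {X : Type*} (r : X → X → Prop) (w : X → X → ℝ) (x y : X) : Set ℝ :=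
  {s : ℝ | ∃ (n : ℕ) (γ : ℕ → X), γ 0 = x ∧ γ n = y ∧
    (∀ i < n, r (γ i) (γ (i + 1))) ∧ s = ∑ i ∈ Finset.range n, w (γ i) (γ (i + 1))}

section pathLengths

variable {X : Type*} {r : X → X → Prop} {w : X → X → ℝ} {x y z : X} {s t : ℝ}

theorem zero_mem_pathLengths (x : X) : 0 ∈ pathLengths r w x x :=
  ⟨0, fun _ => x, rfl, rfl, by simp, by simp⟩

theorem mem_pathLengths_of_rel (h : r x y) : w x y ∈ pathLengths r w x y :=
  ⟨1, fun i => if i = 0 then x else y, by simp, by simp, by simpa using h, by simp⟩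

theorem add_mem_pathLengths (hs : s ∈ pathLengths r w x y) (ht : t ∈ pathLengths r w y z) :
    s + t ∈ pathLengths r w x z := by
  obtain ⟨n, γ, hγ0, hγn, hγ, rfl⟩ := hs
  obtain ⟨k, δ, hδ0, hδk, hδ, rfl⟩ := ht
  have left : ∀ i ≤ n, (if i ≤ n then γ i else δ (i - n)) = γ i := fun i hi => if_pos hi
  have right : ∀ i, (if n + i ≤ n then γ (n + i) else δ (n + i - n)) = δ i := by
    intro i
    rcases Nat.eq_zero_or_pos i with rfl | hi
    · simp [hγn, hδ0]
    · rw [if_neg (by omega), Nat.add_sub_cancel_left]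
  refine ⟨n + k, fun i => if i ≤ n then γ i else δ (i - n), by simpa using hγ0,
    (right k).trans hδk, fun i hi => ?_, ?_⟩
  · dsimp only
    rcases lt_or_ge i n with hin | hin
    · rw [left i hin.le, left (i + 1) hin]
      exact hγ i hin
    · obtain ⟨j, rfl⟩ := Nat.exists_eq_add_of_le hin
      rw [right j, add_assoc, right (j + 1)]
      exact hδ j (by omega)
  · rw [Finset.sum_range_add]
    congr 1
    · refine Finset.sum_congr rfl fun i hi => ?_
      have hin := Finset.mem_range.mp hi
      dsimp only
      rw [left i hin.le, left (i + 1) hin]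
    · refine Finset.sum_congr rfl fun j _ => ?_
      dsimp only
      rw [right j, add_assoc, right (j + 1)]

theorem mem_pathLengths_symm (hr : ∀ u v, r u v → r v u) (hw : ∀ u v, w u v = w v u)
    (hs : s ∈ pathLengths r w x y) : s ∈ pathLengths r w y x := by
  obtain ⟨n, γ, hγ0, hγn, hγ, rfl⟩ := hs
  refine ⟨n, fun i => γ (n - i), by simpa using hγn, by simpa using hγ0, fun i hi => ?_, ?_⟩
  · have h := hr _ _ (hγ (n - (i + 1)) (by omega))
    rwa [show n - (i + 1) + 1 = n - i by omega] at h
  · rw [← Finset.sum_range_reflect]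
    refine Finset.sum_congr rfl fun i hi => ?_
    have hin := Finset.mem_range.mp hi
    rw [hw, show n - 1 - i + 1 = n - i by omega, show n - 1 - i = n - (i + 1) by omega]

theorem pathLengths_nonempty (h : Relation.ReflTransGen r x y) :
    (pathLengths r w x y).Nonempty := by
  induction h with
  | refl => exact ⟨0, zero_mem_pathLengths x⟩
  | tail _ hr ih =>
    obtain ⟨s, hs⟩ := ih
    exact ⟨_, add_mem_pathLengths hs (mem_pathLengths_of_rel hr)⟩

theorem nonneg_of_mem_pathLengths (hw : ∀ u v, 0 ≤ w u v) (hs : s ∈ pathLengths r w x y) :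
    0 ≤ s := by
  obtain ⟨n, γ, -, -, -, rfl⟩ := hs
  exact Finset.sum_nonneg fun i _ => hw _ _

theorem bddBelow_pathLengths (hw : ∀ u v, 0 ≤ w u v) : BddBelow (pathLengths r w x y) :=
  ⟨0, fun _ hs => nonneg_of_mem_pathLengths hw hs⟩

end pathLengths

section rho0

variable {X : Type*} {m : X → ℝ} {b : X → X → ℝ}

/-- The length `(max (Deg u) (Deg v))^{-1/2}` of the edge `(u, v)` in the degree path metric. -/
noncomputable def edgeLength (m : X → ℝ) (b : X → X → ℝ) (u v : X) : ℝ :=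
  (Real.sqrt (max (Deg m b u) (Deg m b v)))⁻¹

theorem edgeLength_nonneg (u v : X) : 0 ≤ edgeLength m b u v :=
  inv_nonneg.mpr (Real.sqrt_nonneg _)

theorem edgeLength_comm (u v : X) : edgeLength m b u v = edgeLength m b v u := by
  rw [edgeLength, edgeLength, max_comm]

theorem rho0_eq_sInf_pathLengths (x y : X) :
    rho0 m b x y = sInf (pathLengths (fun u v => 0 < b u v) (edgeLength m b) x y) :=
  rfl

theorem rho0_nonneg (x y : X) : 0 ≤ rho0 m b x y := by
  rw [rho0_eq_sInf_pathLengths]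
  exact Real.sInf_nonneg fun _ hs => nonneg_of_mem_pathLengths edgeLength_nonneg hs

theorem rho0_self (x : X) : rho0 m b x x = 0 := by
  refine le_antisymm ?_ (rho0_nonneg x x)
  rw [rho0_eq_sInf_pathLengths]
  exact csInf_le (bddBelow_pathLengths edgeLength_nonneg) (zero_mem_pathLengths x)

theorem rho0_comm (hb_symm : ∀ x y, b x y = b y x) (x y : X) :
    rho0 m b x y = rho0 m b y x := by
  have hr : ∀ u v, 0 < b u v → 0 < b v u := fun u v h => hb_symm u v ▸ h
  rw [rho0_eq_sInf_pathLengths, rho0_eq_sInf_pathLengths]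
  congr 1
  ext s
  exact ⟨mem_pathLengths_symm hr edgeLength_comm, mem_pathLengths_symm hr edgeLength_comm⟩

theorem rho0_triangle
    (hconn : ∀ x y : X, Relation.ReflTransGen (fun u v : X => 0 < b u v) x y) (x y z : X) :
    rho0 m b x z ≤ rho0 m b x y + rho0 m b y z := by
  have hxy := pathLengths_nonempty (w := edgeLength m b) (hconn x y)
  have hyz := pathLengths_nonempty (w := edgeLength m b) (hconn y z)
  simp only [rho0_eq_sInf_pathLengths]
  rw [← csInf_add hxy (bddBelow_pathLengths edgeLength_nonneg)
    hyz (bddBelow_pathLengths edgeLength_nonneg)]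
  refine csInf_le_csInf (bddBelow_pathLengths edgeLength_nonneg) (hxy.add hyz) ?_
  rintro _ ⟨s, hs, t, ht, rfl⟩
  exact add_mem_pathLengths hs ht

theorem rho0_sq_le_inv_Deg {x y : X} (hDeg : 0 < Deg m b x) (h : 0 < b x y) :
    rho0 m b x y ^ 2 ≤ (Deg m b x)⁻¹ := by
  have hle : rho0 m b x y ≤ edgeLength m b x y := by
    rw [rho0_eq_sInf_pathLengths]
    exact csInf_le (bddBelow_pathLengths edgeLength_nonneg) (mem_pathLengths_of_rel h)
  calc rho0 m b x y ^ 2 ≤ edgeLength m b x y ^ 2 := by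
        gcongr
        exact rho0_nonneg x y
    _ = (max (Deg m b x) (Deg m b y))⁻¹ := by
        rw [edgeLength, inv_pow, Real.sq_sqrt (hDeg.le.trans (le_max_left _ _))]
    _ ≤ (Deg m b x)⁻¹ := inv_anti₀ hDeg (le_max_left _ _)

theorem tsum_mul_rho0_sq_le (hm : ∀ x, 0 < m x) (hb_nonneg : ∀ x y, 0 ≤ b x y)
    (hb_sum : ∀ x, Summable fun y => b x y) (x : X) :
    ∑' y, ENNReal.ofReal (b x y * rho0 m b x y ^ 2) ≤ ENNReal.ofReal (m x) := by
  have hle : ∀ y, b x y * rho0 m b x y ^ 2 ≤ b x y * (Deg m b x)⁻¹ := by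
    intro y
    rcases (hb_nonneg x y).eq_or_lt with h | h
    · simp [← h]
    · have hDeg : 0 < Deg m b x :=
        mul_pos (one_div_pos.mpr (hm x)) ((hb_sum x).tsum_pos (hb_nonneg x) y h)
      exact mul_le_mul_of_nonneg_left (rho0_sq_le_inv_Deg hDeg h) h.le
  have hDeg : 0 ≤ Deg m b x :=
    mul_nonneg (one_div_pos.mpr (hm x)).le (tsum_nonneg (hb_nonneg x))
  calc ∑' y, ENNReal.ofReal (b x y * rho0 m b x y ^ 2)
      ≤ ∑' y, ENNReal.ofReal (b x y * (Deg m b x)⁻¹) :=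
        ENNReal.tsum_le_tsum fun y => ENNReal.ofReal_le_ofReal (hle y)
    _ = ENNReal.ofReal (∑' y, b x y * (Deg m b x)⁻¹) :=
        (ENNReal.ofReal_tsum_of_nonneg
          (fun y => mul_nonneg (hb_nonneg x y) (inv_nonneg.mpr hDeg))
          ((hb_sum x).mul_right _)).symm
    _ ≤ ENNReal.ofReal (m x) := by
        refine ENNReal.ofReal_le_ofReal ?_
        rw [tsum_mul_right, Deg]
        rcases eq_or_ne (∑' y, b x y) 0 with h | h
        · simpa [h] using (hm x).le
        · have := (hm x).ne'
          exact le_of_eq (by field_simp)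

end rho0

theorem degree_path_metric_is_intrinsic
    {X : Type*} [Countable X] [Infinite X]
    (m : X → ℝ) (hm : ∀ x, 0 < m x)
    (b : X → X → ℝ) (hb_symm : ∀ x y, b x y = b y x)
    (hb_nonneg : ∀ x y, 0 ≤ b x y) (hb_diag : ∀ x, b x x = 0)
    (hb_sum : ∀ x, Summable fun y => b x y)
    (hconn : ∀ x y : X, Relation.ReflTransGen (fun u v : X => 0 < b u v) x y) :
    (∀ x, rho0 m b x x = 0) ∧
    (∀ x y, 0 ≤ rho0 m b x y) ∧
    (∀ x y, rho0 m b x y = rho0 m b y x) ∧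
    (∀ x y z, rho0 m b x z ≤ rho0 m b x y + rho0 m b y z) ∧
    (∀ x, ∑' y, ENNReal.ofReal (b x y * (rho0 m b x y) ^ 2) ≤ ENNReal.ofReal (m x)) := by
  exact ⟨rho0_self, rho0_nonneg, rho0_comm hb_symm, rho0_triangle hconn,
    tsum_mul_rho0_sq_le hm hb_nonneg hb_sum⟩

end Stmt4
end

section
/- Let b be a connected graph over (X,m) and let d be the combinatorial graph distance, d(x,y) = the minimal n ≥ 0 such that there is a path x = x₀ ∼ x₁ ∼ … ∼ x_n = y. Then the following are equivalent: (i) there exist an intrinsic metric ρ and a constant C ≥ 1 such that C^{−1} ρ(x,y) ≤ d(x,y) ≤ C ρ(x,y) for all x,y ∈ X; (ii) the weighted vertex degree Deg is a bounded function on X. -/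
/-!
STATEMENT 5: The combinatorial graph distance is equivalent to an intrinsic metric
iff the weighted vertex degree `Deg` is bounded.
-/

open scoped ENNReal

namespace Stmt5

/-- A pseudo metric: symmetric, nonnegative, zero diagonal, triangle inequality. -/
structure IsPseudoMetric {X : Type*} (ρ : X → X → ℝ) : Prop where
  nonneg : ∀ x y, 0 ≤ ρ x y
  refl : ∀ x, ρ x x = 0
  symm : ∀ x y, ρ x y = ρ y x
  triangle : ∀ x y z, ρ x z ≤ ρ x y + ρ y z

/-- An intrinsic metric for the graph `b` over `(X,m)`. -/
def IsIntrinsic {X : Type*} (m : X → ℝ) (b : X → X → ℝ) (ρ : X → X → ℝ) : Prop :=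
  IsPseudoMetric ρ ∧
    ∀ x, ∑' y, ENNReal.ofReal (b x y * (ρ x y) ^ 2) ≤ ENNReal.ofReal (m x)

/-- The combinatorial graph distance: the minimal number of edges of a path
joining two vertices. -/
noncomputable def combDist {X : Type*} (b : X → X → ℝ) (x y : X) : ℕ :=
  sInf {n : ℕ | ∃ γ : ℕ → X, γ 0 = x ∧ γ n = y ∧ ∀ i < n, 0 < b (γ i) (γ (i + 1))}

/-- The weighted vertex degree `Deg(x) = (1/m x) ∑_y b x y`. -/
noncomputable def Deg {X : Type*} (m : X → ℝ) (b : X → X → ℝ) (x : X) : ℝ :=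
  (1 / m x) * ∑' y, b x y

/-- `HasPath b n x y` says that `x` and `y` are joined by a path with `n` edges. -/
def HasPath {X : Type*} (b : X → X → ℝ) (n : ℕ) (x y : X) : Prop :=
  ∃ γ : ℕ → X, γ 0 = x ∧ γ n = y ∧ ∀ i < n, 0 < b (γ i) (γ (i + 1))

section Paths

variable {X : Type*} {b : X → X → ℝ} {x y z : X} {k n : ℕ}

lemma HasPath.nil (b : X → X → ℝ) (x : X) : HasPath b 0 x x :=
  ⟨fun _ => x, rfl, rfl, fun _ hi => absurd hi (Nat.not_lt_zero _)⟩

lemma HasPath.eq (h : HasPath b 0 x y) : x = y := by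
  obtain ⟨γ, h0, h1, -⟩ := h
  exact h0.symm.trans h1

lemma HasPath.single (h : 0 < b x y) : HasPath b 1 x y := by
  refine ⟨fun i => if i = 0 then x else y, by simp, by simp, fun i hi => ?_⟩
  obtain rfl : i = 0 := by omega
  simpa using h

lemma HasPath.trans (h₁ : HasPath b k x y) (h₂ : HasPath b n y z) :
    HasPath b (k + n) x z := by
  obtain ⟨γ, hγ0, hγk, hγ⟩ := h₁
  obtain ⟨δ, hδ0, hδn, hδ⟩ := h₂
  refine ⟨fun i => if i < k then γ i else δ (i - k), ?_, by simp [hδn], fun i hi => ?_⟩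
  · rcases Nat.eq_zero_or_pos k with rfl | hk
    · simp [hδ0, ← hγk, hγ0]
    · simp [hk, hγ0]
  · dsimp only
    by_cases h : i < k
    · rw [if_pos h]
      by_cases h' : i + 1 < k
      · rw [if_pos h']
        exact hγ i h
      · obtain rfl : k = i + 1 := by omega
        simpa [hδ0, ← hγk] using hγ i h
    · rw [if_neg h, if_neg (by omega), Nat.sub_add_comm (by omega)]
      exact hδ _ (by omega)

lemma HasPath.symm (hb : ∀ x y, b x y = b y x) (h : HasPath b n x y) : HasPath b n y x := by
  obtain ⟨γ, h0, hn, hγ⟩ := h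
  refine ⟨fun i => γ (n - i), by simpa using hn, by simpa using h0, fun i hi => ?_⟩
  have h := hγ (n - (i + 1)) (by omega)
  rwa [show n - (i + 1) + 1 = n - i by omega, hb] at h

lemma exists_hasPath (h : Relation.ReflTransGen (fun u v : X => 0 < b u v) x y) :
    ∃ n, HasPath b n x y := by
  induction h with
  | refl => exact ⟨0, .nil b x⟩
  | tail _ h ih =>
    obtain ⟨n, hn⟩ := ih
    exact ⟨n + 1, hn.trans (.single h)⟩

lemma combDist_le (h : HasPath b n x y) : combDist b x y ≤ n := Nat.sInf_le h

lemma HasPath.combDist (h : HasPath b n x y) : HasPath b (combDist b x y) x y :=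
  Nat.sInf_mem (s := {n | HasPath b n x y}) ⟨n, h⟩

lemma isPseudoMetric_combDist (hb : ∀ x y, b x y = b y x)
    (hconn : ∀ x y : X, Relation.ReflTransGen (fun u v : X => 0 < b u v) x y) :
    IsPseudoMetric fun x y => (combDist b x y : ℝ) := by
  have hpath (x y : X) : HasPath b (combDist b x y) x y :=
    (exists_hasPath (hconn x y)).elim fun _ h => h.combDist
  refine ⟨fun _ _ => Nat.cast_nonneg _, fun x => ?_, fun x y => ?_, fun x y z => ?_⟩
  · exact_mod_cast Nat.le_zero.mp (combDist_le (.nil b x))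
  · exact_mod_cast (combDist_le ((hpath y x).symm hb)).antisymm
      (combDist_le ((hpath x y).symm hb))
  · exact_mod_cast combDist_le ((hpath x y).trans (hpath y z))

lemma one_le_combDist (hb : ∀ x, b x x = 0) (h : 0 < b x y) : 1 ≤ combDist b x y := by
  by_contra! h0
  have hp := (HasPath.single h).combDist
  rw [Nat.lt_one_iff.mp h0] at hp
  rw [hp.eq, hb] at h
  exact h.false

end Paths

lemma IsPseudoMetric.const_mul {X : Type*} {ρ : X → X → ℝ} (h : IsPseudoMetric ρ) {c : ℝ}
    (hc : 0 ≤ c) : IsPseudoMetric fun x y => c * ρ x y where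
  nonneg x y := mul_nonneg hc (h.nonneg x y)
  refl x := by simp [h.refl]
  symm x y := by rw [h.symm]
  triangle x y z := by
    rw [← mul_add]
    exact mul_le_mul_of_nonneg_left (h.triangle x y z) hc

theorem combinatorial_distance_equivalent_to_intrinsic_iff_bounded_degree
    {X : Type*} [Countable X] [Infinite X]
    (m : X → ℝ) (hm : ∀ x, 0 < m x)
    (b : X → X → ℝ) (hb_symm : ∀ x y, b x y = b y x)
    (hb_nonneg : ∀ x y, 0 ≤ b x y) (hb_diag : ∀ x, b x x = 0)
    (hb_sum : ∀ x, Summable fun y => b x y)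
    (hconn : ∀ x y : X, Relation.ReflTransGen (fun u v : X => 0 < b u v) x y) :
    (∃ (ρ : X → X → ℝ) (C : ℝ), 1 ≤ C ∧ IsIntrinsic m b ρ ∧
        ∀ x y, C⁻¹ * ρ x y ≤ (combDist b x y : ℝ) ∧ (combDist b x y : ℝ) ≤ C * ρ x y) ↔
    (∃ D : ℝ, ∀ x, Deg m b x ≤ D) := by
  constructor
  · rintro ⟨ρ, C, hC, ⟨-, hint⟩, hρ⟩
    refine ⟨C ^ 2, fun x => ?_⟩
    have hC0 : 0 < C := by linarith
    have hle (y : X) : b x y ≤ C ^ 2 * (b x y * ρ x y ^ 2) := by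
      rcases (hb_nonneg x y).eq_or_lt with h | h
      · simp [← h]
      · have h1 : (1 : ℝ) ≤ combDist b x y := by exact_mod_cast one_le_combDist hb_diag h
        have h2 : 1 ≤ (C * ρ x y) ^ 2 := one_le_pow₀ (h1.trans (hρ x y).2)
        nlinarith
    have hsum : ENNReal.ofReal (∑' y, b x y) ≤ ENNReal.ofReal (C ^ 2 * m x) := by
      rw [ENNReal.ofReal_tsum_of_nonneg (hb_nonneg x) (hb_sum x),
        ENNReal.ofReal_mul (sq_nonneg C)]
      calc ∑' y, ENNReal.ofReal (b x y)
          ≤ ∑' y, ENNReal.ofReal (C ^ 2) * ENNReal.ofReal (b x y * ρ x y ^ 2) := by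
            refine ENNReal.tsum_le_tsum fun y => ?_
            rw [← ENNReal.ofReal_mul (sq_nonneg C)]
            exact ENNReal.ofReal_le_ofReal (hle y)
        _ ≤ _ := by
            rw [ENNReal.tsum_mul_left]
            gcongr
            exact hint x
    have h := (ENNReal.ofReal_le_ofReal_iff (mul_nonneg (sq_nonneg C) (hm x).le)).mp hsum
    rw [Deg, one_div, inv_mul_le_iff₀ (hm x)]
    linarith
  · rintro ⟨D, hD⟩
    have hE1 : 1 ≤ max D 1 := le_max_right _ _
    have hDE : D ≤ max D 1 := le_max_left _ _
    generalize max D 1 = E at hE1 hDE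
    have hE : 0 < E := by linarith
    have hs : 1 ≤ √E := Real.one_le_sqrt.mpr hE1
    have hs0 : 0 < √E := by linarith
    refine ⟨fun x y => (√E)⁻¹ * combDist b x y, √E, hs,
      ⟨(isPseudoMetric_combDist hb_symm hconn).const_mul (by positivity), fun x => ?_⟩,
      fun x y => ⟨?_, ?_⟩⟩
    · have hle (y : X) : b x y * ((√E)⁻¹ * combDist b x y) ^ 2 ≤ E⁻¹ * b x y := by
        rw [mul_pow, inv_pow, Real.sq_sqrt hE.le]
        rcases (hb_nonneg x y).eq_or_lt with h | h
        · simp [← h]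
        · have h1 : (combDist b x y : ℝ) ≤ 1 := by
            exact_mod_cast combDist_le (HasPath.single h)
          have h2 : (combDist b x y : ℝ) ^ 2 ≤ 1 := pow_le_one₀ (Nat.cast_nonneg _) h1
          have h3 : 0 < E⁻¹ * b x y := by positivity
          nlinarith
      have hdeg : ∑' y, b x y ≤ m x * E := by
        have h := (hD x).trans hDE
        rwa [Deg, one_div, inv_mul_le_iff₀ (hm x)] at h
      calc ∑' y, ENNReal.ofReal (b x y * ((√E)⁻¹ * combDist b x y) ^ 2)
          ≤ ∑' y, ENNReal.ofReal (E⁻¹ * b x y) :=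
            ENNReal.tsum_le_tsum fun y => ENNReal.ofReal_le_ofReal (hle y)
        _ = ENNReal.ofReal (E⁻¹ * ∑' y, b x y) := by
            rw [← tsum_mul_left, ENNReal.ofReal_tsum_of_nonneg
              (fun y => mul_nonneg (by positivity) (hb_nonneg x y)) ((hb_sum x).mul_left _)]
        _ ≤ ENNReal.ofReal (m x) := by
            refine ENNReal.ofReal_le_ofReal ?_
            rw [inv_mul_le_iff₀ hE]
            linarith
    · rw [← mul_assoc]
      exact mul_le_of_le_one_left (Nat.cast_nonneg _)
        (mul_le_one₀ (inv_le_one_of_one_le₀ hs) (by positivity) (inv_le_one_of_one_le₀ hs))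
    · rw [mul_inv_cancel_left₀ hs0.ne']

end Stmt5
end

section
/- Let (b,c) be a locally finite connected graph over (X,m) and let ρ be a metric on X (so ρ(x,y) > 0 for x ≠ y) which is a path metric, i.e. ρ(x,y) equals the infimum over all paths x = x₀ ∼ x₁ ∼ … ∼ x_n = y of ∑_{i=1}^n ρ(x_{i−1},x_i), for all x,y ∈ X. Then the following are equivalent: (i) (X,ρ) is a complete metric space; (ii) (X,ρ) is geodesically complete, i.e. every infinite geodesic has infinite length, where a geodesic is a sequence (x_n)_{n≥0} with x_n ∼ x_{n+1} for all n and ρ(x₀,x_n) = ∑_{j=0}^{n−1} ρ(x_j,x_{j+1}) for every n, and its length is ∑_{j≥0} ρ(x_j,x_{j+1}); (iii) every distance ball B_r(x) = {y ∈ X : ρ(x,y) ≤ r} is a finite set. -/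
/-!
STATEMENT 7: Hopf–Rinow type theorem. For a locally finite connected graph with a
path metric `ρ`, the following are equivalent: (i) metric completeness of `(X,ρ)`,
(ii) geodesic completeness (every infinite geodesic has infinite length),
(iii) all distance balls are finite.
-/

namespace Stmt7

section PathMetric

variable {X : Type*} {b ρ : X → X → ℝ}

/-- The distance between the endpoints of a finite path is at most its length. -/
lemma dist_le_path_length (hrefl : ∀ x, ρ x x = 0)
    (htriangle : ∀ x y z, ρ x z ≤ ρ x y + ρ y z) (γ : ℕ → X) (n : ℕ) :
    ρ (γ 0) (γ n) ≤ ∑ i ∈ Finset.range n, ρ (γ i) (γ (i + 1)) := by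
  induction n with
  | zero => simp [hrefl]
  | succ n ih =>
    rw [Finset.sum_range_succ]
    linarith [htriangle (γ 0) (γ n) (γ (n + 1))]

/-- In a locally finite graph with a path metric, some neighbor of `x` lies between `x` and any
given other vertex `y`. -/
lemma exists_neighbor_between (hloc : ∀ x : X, {y | 0 < b x y}.Finite)
    (hrefl : ∀ x, ρ x x = 0) (htriangle : ∀ x y z, ρ x z ≤ ρ x y + ρ y z)
    (hsep : ∀ x y, ρ x y = 0 → x = y)
    (hpath : ∀ x y, ρ x y = sInf {s : ℝ | ∃ (n : ℕ) (γ : ℕ → X),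
      γ 0 = x ∧ γ n = y ∧ (∀ i < n, 0 < b (γ i) (γ (i + 1))) ∧
      s = ∑ i ∈ Finset.range n, ρ (γ i) (γ (i + 1))})
    {x y : X} (hxy : x ≠ y) : ∃ z, 0 < b x z ∧ ρ x y = ρ x z + ρ z y := by
  set A := {s : ℝ | ∃ (n : ℕ) (γ : ℕ → X),
      γ 0 = x ∧ γ n = y ∧ (∀ i < n, 0 < b (γ i) (γ (i + 1))) ∧
      s = ∑ i ∈ Finset.range n, ρ (γ i) (γ (i + 1))} with hA
  have first_step : ∀ s ∈ A, ∃ z, 0 < b x z ∧ ρ x z + ρ z y ≤ s := by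
    rintro s ⟨n, γ, rfl, rfl, hγ, rfl⟩
    obtain _ | n := n
    · exact absurd rfl hxy
    · refine ⟨γ 1, hγ 0 n.succ_pos, ?_⟩
      rw [Finset.sum_range_succ']
      linarith [dist_le_path_length hrefl htriangle (fun i => γ (i + 1)) n]
  have hne : A.Nonempty := by
    by_contra h
    rw [Set.not_nonempty_iff_eq_empty] at h
    exact hxy (hsep x y (by rw [hpath x y, ← hA, h, Real.sInf_empty]))
  obtain ⟨s, hs⟩ := hne
  obtain ⟨w, hw, -⟩ := first_step s hs
  obtain ⟨z, hz, hmin⟩ := Set.exists_min_image _ (fun z => ρ x z + ρ z y) (hloc x) ⟨w, hw⟩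
  refine ⟨z, hz, le_antisymm (htriangle x z y) ?_⟩
  rw [hpath x y]
  refine le_csInf ⟨s, hs⟩ fun t ht => ?_
  obtain ⟨v, hv, hvt⟩ := first_step t ht
  exact (hmin v hv).trans hvt

/-- If every vertex distinct from `x` is separated from it by a neighbor of `x`, then `x` is
isolated. -/
lemma exists_pos_le_dist (hb_diag : ∀ x, b x x = 0) (hloc : ∀ x : X, {y | 0 < b x y}.Finite)
    (hnonneg : ∀ x y, 0 ≤ ρ x y) (hsep : ∀ x y, ρ x y = 0 → x = y)
    (hbetween : ∀ x y, x ≠ y → ∃ z, 0 < b x z ∧ ρ x y = ρ x z + ρ z y) (x : X) :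
    ∃ δ > 0, ∀ y, x ≠ y → δ ≤ ρ x y := by
  obtain hempty | hne := {y | 0 < b x y}.eq_empty_or_nonempty
  · refine ⟨1, one_pos, fun y hy => ?_⟩
    obtain ⟨z, hz, -⟩ := hbetween x y hy
    exact absurd hz (Set.eq_empty_iff_forall_notMem.mp hempty z)
  · obtain ⟨w, hw, hmin⟩ := Set.exists_min_image _ (ρ x) (hloc x) hne
    refine ⟨ρ x w, (hnonneg x w).lt_of_ne fun h => ?_, fun y hy => ?_⟩
    · have hxw := hsep x w h.symm
      subst hxw
      exact (hb_diag x).not_gt hw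
    · obtain ⟨z, hz, hzy⟩ := hbetween x y hy
      linarith [hmin z hz, hnonneg z y]

/-- An infinite ball in a locally finite graph contains an infinite geodesic from its center. -/
lemma exists_geodesic_of_infinite_ball (hloc : ∀ x : X, {y | 0 < b x y}.Finite)
    (hnonneg : ∀ x y, 0 ≤ ρ x y) (hrefl : ∀ x, ρ x x = 0)
    (htriangle : ∀ x y z, ρ x z ≤ ρ x y + ρ y z)
    (hbetween : ∀ x y, x ≠ y → ∃ z, 0 < b x z ∧ ρ x y = ρ x z + ρ z y)
    {o : X} {r : ℝ} (hball : {y | ρ o y ≤ r}.Infinite) :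
    ∃ γ : ℕ → X, (∀ n, 0 < b (γ n) (γ (n + 1))) ∧
      (∀ n : ℕ, ρ (γ 0) (γ n) = ∑ j ∈ Finset.range n, ρ (γ j) (γ (j + 1))) ∧
      ∀ n, ρ (γ 0) (γ n) ≤ r := by
  let S : X → Set X := fun x => {y | ρ o y ≤ r ∧ ρ o y = ρ o x + ρ x y}
  have step : ∀ x : {x // (S x).Infinite}, ∃ z : {x // (S x).Infinite},
      0 < b x z ∧ ρ o z = ρ o x + ρ x z := by
    rintro ⟨x, hx⟩
    by_contra! h
    refine hx (((Set.finite_singleton x).union (((hloc x).subset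
      (Set.sep_subset _ fun z => ρ o z = ρ o x + ρ x z)).biUnion (t := S)
        fun z hz => ?_)).subset fun y hy => ?_)
    · by_contra hinf
      exact h ⟨z, hinf⟩ hz.1 hz.2
    · by_cases hxy : x = y
      · exact Or.inl hxy.symm
      · obtain ⟨z, hz, hzy⟩ := hbetween x y hxy
        have hoz := htriangle o x z
        have hoy := htriangle o z y
        have hy2 := hy.2
        exact Or.inr (Set.mem_biUnion (x := z) ⟨hz, by linarith⟩ ⟨hy.1, by linarith⟩)
  choose next hadj hdist using step
  have ho : (S o).Infinite := by simpa [S, hrefl] using hball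
  let γ : ℕ → {x // (S x).Infinite} := fun n => next^[n] ⟨o, ho⟩
  have hγ : ∀ n, γ (n + 1) = next (γ n) := fun n => Function.iterate_succ_apply' next n _
  refine ⟨fun n => γ n, fun n => ?_, fun n => ?_, fun n => ?_⟩
  · simpa only [hγ] using hadj (γ n)
  · induction n with
    | zero => simp [hrefl]
    | succ n ih =>
      rw [Finset.sum_range_succ, ← ih]
      have hnext := hdist (γ n)
      rw [← hγ] at hnext
      exact hnext
  · obtain ⟨y, hyr, hy⟩ := (γ n).2.nonempty
    change ρ o (γ n) ≤ r
    linarith [hnonneg (γ n : X) y]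

/-- A geodesic of finite length is a Cauchy sequence. -/
lemma cauchy_of_summable_length (hrefl : ∀ x, ρ x x = 0) (hsymm : ∀ x y, ρ x y = ρ y x)
    (htriangle : ∀ x y z, ρ x z ≤ ρ x y + ρ y z) {γ : ℕ → X}
    (hsum : Summable fun j => ρ (γ j) (γ (j + 1))) {ε : ℝ} (hε : 0 < ε) :
    ∃ N : ℕ, ∀ i ≥ N, ∀ j ≥ N, ρ (γ i) (γ j) < ε := by
  obtain ⟨N, hN⟩ := Metric.cauchySeq_iff.mp hsum.hasSum.tendsto_sum_nat.cauchySeq ε hε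
  have ordered : ∀ i ≥ N, ∀ k, ρ (γ i) (γ (i + k)) < ε := fun i hi k => by
    have hd := hN (i + k) (by omega) i hi
    rw [Real.dist_eq, Finset.sum_range_add, add_sub_cancel_left] at hd
    exact (dist_le_path_length hrefl htriangle (fun j => γ (i + j)) k).trans_lt
      ((le_abs_self _).trans_lt hd)
  refine ⟨N, fun i hi j hj => ?_⟩
  obtain h | h := le_total i j
  · obtain ⟨k, rfl⟩ := Nat.exists_eq_add_of_le h
    exact ordered i hi k
  · obtain ⟨k, rfl⟩ := Nat.exists_eq_add_of_le h
    rw [hsymm]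
    exact ordered j hj k

/-- If all balls are finite, every Cauchy sequence converges. -/
lemma exists_limit_of_finite_balls (hball : ∀ (x : X) (r : ℝ), {y | ρ x y ≤ r}.Finite)
    {u : ℕ → X} (hu : ∀ ε : ℝ, 0 < ε → ∃ N : ℕ, ∀ i ≥ N, ∀ j ≥ N, ρ (u i) (u j) < ε) :
    ∃ x : X, ∀ ε : ℝ, 0 < ε → ∃ N : ℕ, ∀ i ≥ N, ρ (u i) x < ε := by
  obtain ⟨N, hN⟩ := hu 1 one_pos
  have hfreq : ∃ x, ∃ᶠ i in Filter.atTop, u i = x := by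
    by_contra! h
    have hev := (Filter.eventually_all_finite (hball (u N) 1)).mpr
      fun x _ => h x
    obtain ⟨i, hi, hiN⟩ := (hev.and (Filter.eventually_ge_atTop N)).exists
    exact hi (u i) (hN N le_rfl i hiN).le rfl
  obtain ⟨x, hx⟩ := hfreq
  refine ⟨x, fun ε hε => ?_⟩
  obtain ⟨M, hM⟩ := hu ε hε
  obtain ⟨j, hj, rfl⟩ := Filter.frequently_atTop.mp hx M
  exact ⟨M, fun i hi => hM i hi j hj⟩

end PathMetric

theorem hopf_rinow
    {X : Type*} [Countable X] [Infinite X]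
    (m : X → ℝ) (hm : ∀ x, 0 < m x)
    (b : X → X → ℝ) (hb_symm : ∀ x y, b x y = b y x)
    (hb_nonneg : ∀ x y, 0 ≤ b x y) (hb_diag : ∀ x, b x x = 0)
    (hb_sum : ∀ x, Summable fun y => b x y)
    (c : X → ℝ) (hc : ∀ x, 0 ≤ c x)
    (hloc : ∀ x : X, {y | 0 < b x y}.Finite)
    (hconn : ∀ x y : X, Relation.ReflTransGen (fun u v : X => 0 < b u v) x y)
    (ρ : X → X → ℝ)
    (hnonneg : ∀ x y, 0 ≤ ρ x y) (hrefl : ∀ x, ρ x x = 0)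
    (hsymm : ∀ x y, ρ x y = ρ y x)
    (htriangle : ∀ x y z, ρ x z ≤ ρ x y + ρ y z)
    (hsep : ∀ x y, ρ x y = 0 → x = y)
    -- ρ is a path metric:
    (hpath : ∀ x y, ρ x y = sInf {s : ℝ | ∃ (n : ℕ) (γ : ℕ → X),
      γ 0 = x ∧ γ n = y ∧ (∀ i < n, 0 < b (γ i) (γ (i + 1))) ∧
      s = ∑ i ∈ Finset.range n, ρ (γ i) (γ (i + 1))}) :
    -- (i) metric completeness
    ((∀ u : ℕ → X,
        (∀ ε : ℝ, 0 < ε → ∃ N : ℕ, ∀ i ≥ N, ∀ j ≥ N, ρ (u i) (u j) < ε) →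
        ∃ x : X, ∀ ε : ℝ, 0 < ε → ∃ N : ℕ, ∀ i ≥ N, ρ (u i) x < ε) ↔
    -- (ii) geodesic completeness: every infinite geodesic has infinite length
      (∀ γ : ℕ → X, (∀ n, 0 < b (γ n) (γ (n + 1))) →
        (∀ n : ℕ, ρ (γ 0) (γ n) = ∑ j ∈ Finset.range n, ρ (γ j) (γ (j + 1))) →
        ¬ Summable (fun j => ρ (γ j) (γ (j + 1))))) ∧
    ((∀ γ : ℕ → X, (∀ n, 0 < b (γ n) (γ (n + 1))) →
        (∀ n : ℕ, ρ (γ 0) (γ n) = ∑ j ∈ Finset.range n, ρ (γ j) (γ (j + 1))) →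
        ¬ Summable (fun j => ρ (γ j) (γ (j + 1)))) ↔
    -- (iii) all distance balls are finite
      (∀ (x : X) (r : ℝ), {y | ρ x y ≤ r}.Finite)) := by
  have hbetween : ∀ x y, x ≠ y → ∃ z, 0 < b x z ∧ ρ x y = ρ x z + ρ z y := fun _ _ hxy =>
    exists_neighbor_between hloc hrefl htriangle hsep hpath hxy
  have finite_of_geodesic : (∀ γ : ℕ → X, (∀ n, 0 < b (γ n) (γ (n + 1))) →
      (∀ n : ℕ, ρ (γ 0) (γ n) = ∑ j ∈ Finset.range n, ρ (γ j) (γ (j + 1))) →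
      ¬ Summable (fun j => ρ (γ j) (γ (j + 1)))) →
      ∀ (x : X) (r : ℝ), {y | ρ x y ≤ r}.Finite := by
    intro h x r
    by_contra hinf
    obtain ⟨γ, hadj, hgeo, hle⟩ :=
      exists_geodesic_of_infinite_ball hloc hnonneg hrefl htriangle hbetween hinf
    exact h γ hadj hgeo (summable_of_sum_range_le (fun _ => hnonneg _ _)
      fun n => (hgeo n).symm.trans_le (hle n))
  have geodesic_of_complete : (∀ u : ℕ → X,
      (∀ ε : ℝ, 0 < ε → ∃ N : ℕ, ∀ i ≥ N, ∀ j ≥ N, ρ (u i) (u j) < ε) →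
      ∃ x : X, ∀ ε : ℝ, 0 < ε → ∃ N : ℕ, ∀ i ≥ N, ρ (u i) x < ε) →
      ∀ γ : ℕ → X, (∀ n, 0 < b (γ n) (γ (n + 1))) →
      (∀ n : ℕ, ρ (γ 0) (γ n) = ∑ j ∈ Finset.range n, ρ (γ j) (γ (j + 1))) →
      ¬ Summable (fun j => ρ (γ j) (γ (j + 1))) := by
    intro h γ hadj _ hsum
    obtain ⟨x, hx⟩ := h γ fun ε hε => cauchy_of_summable_length hrefl hsymm htriangle hsum hε
    obtain ⟨δ, hδ, hsepx⟩ := exists_pos_le_dist hb_diag hloc hnonneg hsep hbetween x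
    obtain ⟨N, hN⟩ := hx δ hδ
    have hconst : ∀ i ≥ N, x = γ i := fun i hi => by
      by_contra hne
      exact (hsepx _ hne).not_gt (hsymm x (γ i) ▸ hN i hi)
    have hloop := hadj N
    rw [← hconst N le_rfl, ← hconst (N + 1) N.le_succ, hb_diag] at hloop
    exact lt_irrefl _ hloop
  have complete_of_finite : (∀ (x : X) (r : ℝ), {y | ρ x y ≤ r}.Finite) → ∀ u : ℕ → X,
      (∀ ε : ℝ, 0 < ε → ∃ N : ℕ, ∀ i ≥ N, ∀ j ≥ N, ρ (u i) (u j) < ε) →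
      ∃ x : X, ∀ ε : ℝ, 0 < ε → ∃ N : ℕ, ∀ i ≥ N, ρ (u i) x < ε :=
    fun h _ hu => exists_limit_of_finite_balls h hu
  exact ⟨⟨geodesic_of_complete, fun h => complete_of_finite (finite_of_geodesic h)⟩,
    ⟨finite_of_geodesic, fun h => geodesic_of_complete (complete_of_finite h)⟩⟩

end Stmt7
end

section
/- Let b be a graph over (X,m), ρ an intrinsic metric with jump size s = sup{ρ(x,y) : x ∼ y} ∈ [0,∞], o ∈ X and 0 < r < R. Define η : X → [0,1] by η(x) = max(0, 1 − ρ(x, B_r(o))/(R−r)), where ρ(x,A) = inf_{a∈A} ρ(x,a). Then for every f : X → ℝ, ∑_{x∈X} f(x)² ∑_{y∈X} b(x,y)(η(x)−η(y))² ≤ (R−r)^{−2} ∑_{x ∈ B_{R+s}(o) ∖ B_{r−s}(o)} f(x)² m(x), where B_t(o) = {y : ρ(o,y) ≤ t}, with the conventions B_{R+s}(o) = X if s = ∞ and B_{r−s}(o) = ∅ if s ≥ r. -/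
/-!
STATEMENT 9: The cut-off estimate. For an intrinsic metric `ρ` with jump size
`s ∈ [0,∞]`, `o ∈ X`, `0 < r < R` and
`η(x) = max (0, 1 - ρ(x, B_r(o))/(R-r))`, one has for every `f : X → ℝ`
`∑_x f(x)² ∑_y b(x,y)(η(x)-η(y))² ≤ (R-r)⁻² ∑_{x ∈ B_{R+s}(o) ∖ B_{r-s}(o)} f(x)² m(x)`,
with the conventions `B_{R+s}(o) = X` if `s = ∞` and `B_{r-s}(o) = ∅` if `s ≥ r`.
Both sides are computed in `[0,∞]`.
-/

open scoped ENNReal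

namespace Stmt9

/-- Distance of a point to a set: `ρ(x,A) = inf_{a ∈ A} ρ(x,a)`. -/
noncomputable def distToSet {X : Type*} (ρ : X → X → ℝ) (A : Set X) (x : X) : ℝ :=
  sInf ((fun a => ρ x a) '' A)

/-- The cut-off function `η(x) = max (0, 1 - ρ(x,B_r(o))/(R-r))`. -/
noncomputable def eta {X : Type*} (ρ : X → X → ℝ) (o : X) (r R : ℝ) (x : X) : ℝ :=
  max 0 (1 - distToSet ρ {a | ρ o a ≤ r} x / (R - r))

/-- The annulus `B_{R+s}(o) ∖ B_{r-s}(o)`, with the conventions `B_{R+s}(o) = X`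
if `s = ∞` and `B_{r-s}(o) = ∅` if `s ≥ r`. -/
def annulus {X : Type*} (ρ : X → X → ℝ) (o : X) (r R : ℝ) (s : ℝ≥0∞) : Set X :=
  {x | ENNReal.ofReal (ρ o x) ≤ ENNReal.ofReal R + s ∧
       ¬ (s < ENNReal.ofReal r ∧ ρ o x ≤ r - s.toReal)}

section CutoffEstimate

variable {X : Type*} {ρ : X → X → ℝ} {o : X} {r R : ℝ}

theorem distToSet_le (hnonneg : ∀ x y, 0 ≤ ρ x y) {A : Set X} {a : X} (ha : a ∈ A) (x : X) :
    distToSet ρ A x ≤ ρ x a := by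
  refine csInf_le ⟨0, ?_⟩ ⟨a, ha, rfl⟩
  rintro _ ⟨c, _, rfl⟩
  exact hnonneg x c

theorem le_distToSet {A : Set X} (hA : A.Nonempty) {x : X} {t : ℝ} (h : ∀ a ∈ A, t ≤ ρ x a) :
    t ≤ distToSet ρ A x := by
  refine le_csInf (hA.image _) ?_
  rintro _ ⟨c, hc, rfl⟩
  exact h c hc

theorem distToSet_nonneg (hnonneg : ∀ x y, 0 ≤ ρ x y) (A : Set X) (x : X) :
    0 ≤ distToSet ρ A x := by
  refine Real.sInf_nonneg ?_
  rintro _ ⟨c, _, rfl⟩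
  exact hnonneg x c

theorem distToSet_sub_le (hnonneg : ∀ x y, 0 ≤ ρ x y)
    (htriangle : ∀ x y z, ρ x z ≤ ρ x y + ρ y z) {A : Set X} (hA : A.Nonempty) (x y : X) :
    distToSet ρ A x - distToSet ρ A y ≤ ρ x y := by
  have h : distToSet ρ A x - ρ x y ≤ distToSet ρ A y := by
    refine le_distToSet hA fun a ha => ?_
    linarith [distToSet_le hnonneg ha x, htriangle x y a]
  linarith

theorem eta_sub_sq_le (hnonneg : ∀ x y, 0 ≤ ρ x y) (hrefl : ∀ x, ρ x x = 0)
    (hsymm : ∀ x y, ρ x y = ρ y x) (htriangle : ∀ x y z, ρ x z ≤ ρ x y + ρ y z)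
    (hr : 0 ≤ r) (hrR : r < R) (x y : X) :
    (eta ρ o r R x - eta ρ o r R y) ^ 2 ≤ (R - r)⁻¹ ^ 2 * ρ x y ^ 2 := by
  have hA : {a | ρ o a ≤ r}.Nonempty := ⟨o, by simpa [hrefl] using hr⟩
  have hpos : 0 < (R - r)⁻¹ := inv_pos.mpr (sub_pos.mpr hrR)
  rw [← mul_pow]
  refine sq_le_sq' (abs_le.mp ?_).1 (abs_le.mp ?_).2 <;>
  · unfold eta
    rw [max_comm 0, max_comm 0]
    refine (abs_max_sub_max_le_abs _ _ _).trans ?_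
    rw [sub_sub_sub_cancel_left, ← sub_div, div_eq_inv_mul, abs_mul, abs_of_pos hpos]
    refine mul_le_mul_of_nonneg_left (abs_le.mpr ⟨?_, ?_⟩) hpos.le
    · linarith [distToSet_sub_le hnonneg htriangle hA x y]
    · linarith [distToSet_sub_le hnonneg htriangle hA y x, hsymm x y]

theorem eta_eq_one (hnonneg : ∀ x y, 0 ≤ ρ x y) (hrefl : ∀ x, ρ x x = 0) {x : X}
    (hx : ρ o x ≤ r) : eta ρ o r R x = 1 := by
  have h : distToSet ρ {a | ρ o a ≤ r} x = 0 :=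
    le_antisymm ((distToSet_le hnonneg hx x).trans_eq (hrefl x)) (distToSet_nonneg hnonneg _ x)
  simp [eta, h]

theorem eta_eq_zero (hrefl : ∀ x, ρ x x = 0) (hsymm : ∀ x y, ρ x y = ρ y x)
    (htriangle : ∀ x y z, ρ x z ≤ ρ x y + ρ y z) (hr : 0 ≤ r) (hrR : r < R) {x : X}
    (hx : R ≤ ρ o x) : eta ρ o r R x = 0 := by
  have h : R - r ≤ distToSet ρ {a | ρ o a ≤ r} x := by
    refine le_distToSet ⟨o, by simpa [hrefl] using hr⟩ fun a ha => ?_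
    have ha' : ρ o a ≤ r := ha
    linarith [htriangle o a x, hsymm a x]
  refine max_eq_left ?_
  rw [sub_nonpos, one_le_div (sub_pos.mpr hrR)]
  exact h

theorem eta_eq_of_notMem_annulus (hnonneg : ∀ x y, 0 ≤ ρ x y) (hrefl : ∀ x, ρ x x = 0)
    (hsymm : ∀ x y, ρ x y = ρ y x) (htriangle : ∀ x y z, ρ x z ≤ ρ x y + ρ y z)
    (hr : 0 ≤ r) (hrR : r < R) {s : ℝ≥0∞} {x y : X}
    (hx : x ∉ annulus ρ o r R s) (hxy : ENNReal.ofReal (ρ x y) ≤ s) :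
    eta ρ o r R x = eta ρ o r R y := by
  have hs : s ≠ ∞ := by
    rintro rfl
    exact hx (by simp [annulus])
  have hxy' : ρ x y ≤ s.toReal := (ENNReal.ofReal_le_iff_le_toReal hs).mp hxy
  have hs0 : 0 ≤ s.toReal := ENNReal.toReal_nonneg
  rcases not_and_or.mp hx with hx | hx
  · have hfar : R + s.toReal < ρ o x := by
      rw [not_le, ← ENNReal.ofReal_toReal hs, ← ENNReal.ofReal_add (hr.trans hrR.le) hs0] at hx
      exact (ENNReal.ofReal_lt_ofReal_iff_of_nonneg (add_nonneg (hr.trans hrR.le) hs0)).mp hx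
    rw [eta_eq_zero hrefl hsymm htriangle hr hrR (by linarith : R ≤ ρ o x),
      eta_eq_zero hrefl hsymm htriangle hr hrR
        (by linarith [htriangle o y x, hsymm x y] : R ≤ ρ o y)]
  · obtain ⟨-, hx⟩ := not_not.mp hx
    rw [eta_eq_one hnonneg hrefl (by linarith : ρ o x ≤ r),
      eta_eq_one hnonneg hrefl (by linarith [htriangle o x y] : ρ o y ≤ r)]

end CutoffEstimate

theorem cutoff_estimate
    {X : Type*} [Countable X] [Infinite X]
    (m : X → ℝ) (hm : ∀ x, 0 < m x)
    (b : X → X → ℝ) (hb_symm : ∀ x y, b x y = b y x)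
    (hb_nonneg : ∀ x y, 0 ≤ b x y) (hb_diag : ∀ x, b x x = 0)
    (hb_sum : ∀ x, Summable fun y => b x y)
    (ρ : X → X → ℝ)
    (hnonneg : ∀ x y, 0 ≤ ρ x y) (hrefl : ∀ x, ρ x x = 0)
    (hsymm : ∀ x y, ρ x y = ρ y x)
    (htriangle : ∀ x y z, ρ x z ≤ ρ x y + ρ y z)
    -- ρ is intrinsic:
    (hintr : ∀ x, ∑' y, ENNReal.ofReal (b x y * (ρ x y) ^ 2) ≤ ENNReal.ofReal (m x))
    -- the jump size s = sup {ρ(x,y) : x ∼ y} ∈ [0,∞]: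
    (s : ℝ≥0∞)
    (hs : s = ⨆ q : {q : X × X // 0 < b q.1 q.2}, ENNReal.ofReal (ρ q.1.1 q.1.2))
    (o : X) (r R : ℝ) (hr : 0 < r) (hrR : r < R) :
    ∀ f : X → ℝ,
      ∑' x : X, ENNReal.ofReal ((f x) ^ 2) *
          (∑' y : X, ENNReal.ofReal (b x y * (eta ρ o r R x - eta ρ o r R y) ^ 2))
        ≤ ENNReal.ofReal ((R - r)⁻¹ ^ 2) *
          ∑' x : (annulus ρ o r R s), ENNReal.ofReal ((f x) ^ 2 * m x) := by
  intro f
  rw [tsum_subtype (annulus ρ o r R s) fun x => ENNReal.ofReal ((f x) ^ 2 * m x),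
    ← ENNReal.tsum_mul_left]
  refine ENNReal.tsum_le_tsum fun x => ?_
  by_cases hx : x ∈ annulus ρ o r R s
  · rw [Set.indicator_of_mem hx, ENNReal.ofReal_mul (sq_nonneg (f x)), mul_left_comm]
    gcongr
    calc _ ≤ ∑' y, ENNReal.ofReal ((R - r)⁻¹ ^ 2) * ENNReal.ofReal (b x y * ρ x y ^ 2) := by
          refine ENNReal.tsum_le_tsum fun y => ?_
          rw [← ENNReal.ofReal_mul (sq_nonneg _), mul_left_comm]
          exact ENNReal.ofReal_le_ofReal (mul_le_mul_of_nonneg_left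
            (eta_sub_sq_le hnonneg hrefl hsymm htriangle hr.le hrR x y) (hb_nonneg x y))
      _ ≤ _ := by
          rw [ENNReal.tsum_mul_left]
          gcongr
          exact hintr x
  · have hzero : ∀ y, ENNReal.ofReal (b x y * (eta ρ o r R x - eta ρ o r R y) ^ 2) = 0 := by
      intro y
      rcases (hb_nonneg x y).eq_or_lt with hb | hb
      · simp [← hb]
      · have hxy : ENNReal.ofReal (ρ x y) ≤ s := hs ▸ le_iSup
          (fun q : {q : X × X // 0 < b q.1 q.2} => ENNReal.ofReal (ρ q.1.1 q.1.2)) ⟨(x, y), hb⟩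
        simp [eta_eq_of_notMem_annulus hnonneg hrefl hsymm htriangle hr.le hrR hx hxy]
    simp [hzero]

end Stmt9
end

section
/- Let (b,c) be a connected graph over (X,m) and let ρ be an intrinsic metric such that the weighted vertex degree Deg is bounded on every distance ball (condition (D)). If p ∈ (1,∞) and f ∈ ℓ^p(X,m) is a positive subharmonic function, then f is constant. -/
/-!
STATEMENT 10: Yau's theorem for graphs. If `ρ` is an intrinsic metric with degree
bounded on balls (D), and `f ∈ ℓ^p(X,m)`, `p ∈ (1,∞)`, is a positive subharmonic
function, then `f` is constant.
-/

open scoped ENNReal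

namespace Stmt10

/-- The formal Laplacian `𝓛 f (x) = (1/m x) ∑_y b x y (f x - f y) + (c x / m x) f x`. -/
noncomputable def lap {X : Type*} (m : X → ℝ) (b : X → X → ℝ) (c : X → ℝ)
    (f : X → ℝ) (x : X) : ℝ :=
  (1 / m x) * (∑' y, b x y * (f x - f y)) + (c x / m x) * f x

/-- The weighted vertex degree `Deg(x) = (1/m x) ∑_y b x y`. -/
noncomputable def Deg {X : Type*} (m : X → ℝ) (b : X → X → ℝ) (x : X) : ℝ :=
  (1 / m x) * ∑' y, b x y

lemma min_one_mul_one_sub_le {q t : ℝ} (hq : 0 < q) (ht0 : 0 ≤ t) (ht1 : t ≤ 1) :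
    min 1 q * (1 - t) ≤ 1 - t ^ q := by
  rcases le_total 1 q with h | h
  · rw [min_eq_left h]
    have := Real.rpow_le_rpow_of_exponent_ge' ht0 ht1 zero_le_one h
    rw [Real.rpow_one] at this
    linarith
  · rw [min_eq_right h]
    have := rpow_one_add_le_one_add_mul_self (s := t - 1) (by linarith) hq.le h
    rw [show 1 + (t - 1) = t by ring] at this
    linarith

lemma cutoff_energy_lower_bound_normalized {k t s α β r : ℝ} (hk : 0 < k) (ht0 : 0 ≤ t)
    (ht1 : t ≤ 1) (hs0 : 0 ≤ s) (hs1 : s ≤ 1) (hs : k * (1 - t) ≤ 1 - s) (hα : 0 ≤ α)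
    (hr : |α - β| ≤ r) :
    k / 2 * (α * (1 - t)) ^ 2 ≤
      (1 - t) * (α ^ 2 - β ^ 2 * s) + (2 / k + 1) * r ^ 2 := by
  have hr0 : 0 ≤ r := (abs_nonneg _).trans hr
  have hsq : (α - β) ^ 2 ≤ r ^ 2 := sq_le_sq' (abs_le.1 hr).1 (abs_le.1 hr).2
  have h1 : 0 ≤ 1 - t := by linarith
  have hmain : k * (α * (1 - t)) ^ 2 ≤ (1 - t) * (α ^ 2 * (1 - s)) := by
    have := mul_le_mul_of_nonneg_left hs (mul_nonneg h1 (sq_nonneg α))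
    linarith
  have hcross : -(2 * (α * (1 - t)) * r) ≤ (1 - t) * s * (2 * α * (α - β)) := by
    have h2 : -r ≤ s * (α - β) := by
      have h3 : |s * (α - β)| ≤ r := by
        rw [abs_mul, abs_of_nonneg hs0]
        exact (mul_le_of_le_one_left (abs_nonneg _) hs1).trans hr
      exact (abs_le.1 h3).1
    have := mul_le_mul_of_nonneg_left h2 (mul_nonneg hα h1)
    linarith
  have hlast : (1 - t) * s * (α - β) ^ 2 ≤ r ^ 2 := by
    have : (1 - t) * s ≤ 1 := mul_le_one₀ (by linarith) hs0 hs1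
    exact (mul_le_of_le_one_left (sq_nonneg _) this).trans hsq
  have hyoung : 2 * (α * (1 - t)) * r ≤ k / 2 * (α * (1 - t)) ^ 2 + 2 / k * r ^ 2 := by
    have h : k / 2 * (α * (1 - t)) ^ 2 + 2 / k * r ^ 2 - 2 * (α * (1 - t)) * r
        = k / 2 * (α * (1 - t) - 2 / k * r) ^ 2 := by
      field_simp
      ring
    have : 0 ≤ k / 2 * (α * (1 - t) - 2 / k * r) ^ 2 := by positivity
    linarith
  nlinarith [hmain, hcross, hlast, hyoung]

/-- Pointwise lower bound behind the Caccioppoli inequality for the test function `φ² f^(p-1)`. -/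
lemma cutoff_energy_lower_bound {p A B α β r : ℝ} (hp : 1 < p) (hA : 0 < A) (hB : 0 ≤ B)
    (hBA : B ≤ A) (hα : 0 ≤ α) (hr : |α - β| ≤ r) :
    min 1 (p - 1) / 2 * (α * (1 - B / A)) ^ 2 * A ^ p ≤
      (A - B) * (α ^ 2 * A ^ (p - 1) - β ^ 2 * B ^ (p - 1)) +
        (2 / min 1 (p - 1) + 1) * r ^ 2 * A ^ p := by
  have ht0 : 0 ≤ B / A := by positivity
  have ht1 : B / A ≤ 1 := (div_le_one hA).2 hBA
  have hq : 0 < p - 1 := by linarith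
  have h := cutoff_energy_lower_bound_normalized (lt_min one_pos hq) ht0 ht1
    (Real.rpow_nonneg ht0 _) (Real.rpow_le_one ht0 ht1 hq.le)
    (min_one_mul_one_sub_le hq ht0 ht1) hα hr
  have hAp : A ^ p = A * A ^ (p - 1) := by
    rw [← Real.rpow_one_add' hA.le (by linarith)]
    congr 1
    ring
  have hBq : B ^ (p - 1) = (B / A) ^ (p - 1) * A ^ (p - 1) := by
    rw [← Real.mul_rpow ht0 hA.le, div_mul_cancel₀ _ hA.ne']
  have hAB : A - B = (1 - B / A) * A := by field_simp
  have := mul_le_mul_of_nonneg_right h (Real.rpow_nonneg hA.le p)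
  refine this.trans (le_of_eq ?_)
  rw [hBq, hAB, hAp]
  ring

lemma rpow_sub_one_mul_abs_sub_le {p A B : ℝ} (hp : 1 < p) (hA : 0 ≤ A) (hB : 0 ≤ B) :
    A ^ (p - 1) * |A - B| ≤ A ^ p + B ^ p := by
  have hpow : ∀ x : ℝ, 0 ≤ x → x ^ (p - 1) * x = x ^ p := fun x hx => by
    rw [← Real.rpow_add_one' hx (by linarith)]
    congr 1
    ring
  rcases le_total B A with h | h
  · rw [abs_of_nonneg (by linarith)]
    nlinarith [hpow A hA, Real.rpow_nonneg hB p, mul_nonneg (Real.rpow_nonneg hA (p - 1)) hB]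
  · rw [abs_of_nonpos (by linarith)]
    have h1 : A ^ (p - 1) ≤ B ^ (p - 1) := Real.rpow_le_rpow hA h (by linarith)
    nlinarith [hpow A hA, hpow B hB, Real.rpow_nonneg hA p,
      mul_le_mul_of_nonneg_right h1 hB, mul_nonneg (Real.rpow_nonneg hA (p - 1)) hA]

lemma summable_prod_and_tsum_le_of_marginal_le {X : Type*} {w : X → X → ℝ} {u m : X → ℝ} {M : ℝ}
    (hw : ∀ x y, 0 ≤ w x y) (hws : ∀ x, Summable (w x)) (hwM : ∀ x, ∑' y, w x y ≤ M * m x)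
    (hu : ∀ x, 0 ≤ u x) (hum : Summable fun x => u x * m x) :
    Summable (fun z : X × X => w z.1 z.2 * u z.1) ∧
      ∑' z : X × X, w z.1 z.2 * u z.1 ≤ M * ∑' x, u x * m x := by
  have hle : ∀ x, ∑' y, w x y * u x ≤ M * (u x * m x) := fun x => by
    rw [tsum_mul_right]
    nlinarith [mul_le_mul_of_nonneg_right (hwM x) (hu x)]
  have hx : Summable fun x => ∑' y, w x y * u x :=
    Summable.of_nonneg_of_le (fun x => tsum_nonneg fun y => mul_nonneg (hw x y) (hu x)) hle
      (hum.mul_left M)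
  have hs : Summable (fun z : X × X => w z.1 z.2 * u z.1) :=
    (summable_prod_of_nonneg fun z => mul_nonneg (hw z.1 z.2) (hu z.1)).2
      ⟨fun x => (hws x).mul_right (u x), hx⟩
  refine ⟨hs, ?_⟩
  rw [hs.tsum_prod, ← tsum_mul_left]
  exact hx.tsum_le_tsum hle (hum.mul_left M)

lemma summable_and_tsum_le_of_tsum_ofReal_le {ι : Type*} {a : ι → ℝ} {M : ℝ} (ha : ∀ i, 0 ≤ a i)
    (hM : 0 ≤ M) (h : ∑' i, ENNReal.ofReal (a i) ≤ ENNReal.ofReal M) :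
    Summable a ∧ ∑' i, a i ≤ M := by
  have hs : Summable a := by
    have := ENNReal.summable_toReal (h.trans_lt ENNReal.ofReal_lt_top).ne
    simpa only [ENNReal.toReal_ofReal (ha _)] using this
  refine ⟨hs, ?_⟩
  rwa [← ENNReal.ofReal_tsum_of_nonneg ha hs, ENNReal.ofReal_le_ofReal_iff hM] at h

set_option maxHeartbeats 1000000 in
/-- Caccioppoli-type estimate: with the cutoff `φ = (R - ρ(x₀,·))₊`, the energy density of a
nonnegative subharmonic function on an edge at `x₀` is controlled by its `ℓ^p` norm. -/
lemma edge_energy_le {X : Type*} {m : X → ℝ} (hm : ∀ x, 0 < m x)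
    {b : X → X → ℝ} (hb_symm : ∀ x y, b x y = b y x) (hb_nonneg : ∀ x y, 0 ≤ b x y)
    (hb_sum : ∀ x, Summable fun y => b x y)
    {ρ : X → X → ℝ} (hnonneg : ∀ x y, 0 ≤ ρ x y) (hrefl : ∀ x, ρ x x = 0)
    (hsymm : ∀ x y, ρ x y = ρ y x) (htriangle : ∀ x y z, ρ x z ≤ ρ x y + ρ y z)
    (hintr : ∀ x, ∑' y, ENNReal.ofReal (b x y * (ρ x y) ^ 2) ≤ ENNReal.ofReal (m x))
    (hD : ∀ (x : X) (r : ℝ), ∃ K : ℝ, ∀ y, ρ x y ≤ r → Deg m b y ≤ K)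
    {p : ℝ} (hp : 1 < p) {f : X → ℝ} (hf : ∀ x, 0 ≤ f x)
    (hflp : Summable fun x => f x ^ p * m x)
    (hsub : ∀ x, ∑' y, b x y * (f x - f y) ≤ 0)
    {x₀ y₀ : X} (hlt : f y₀ < f x₀) {R : ℝ} (hR : 0 ≤ R) :
    b x₀ y₀ * (min 1 (p - 1) / 2 * (R * (1 - f y₀ / f x₀)) ^ 2 * f x₀ ^ p) ≤
      2 * (2 / min 1 (p - 1) + 1) * ∑' x, f x ^ p * m x := by
  set k := min 1 (p - 1) with hkdef
  have hk : 0 < k := lt_min one_pos (by linarith)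
  set φ : X → ℝ := fun x => max 0 (R - ρ x₀ x) with hφ
  have hφ0 : ∀ x, 0 ≤ φ x := fun x => le_max_left _ _
  have hφR : ∀ x, φ x ≤ R := fun x => max_le hR (by linarith [hnonneg x₀ x])
  have hφlip : ∀ x y, |φ x - φ y| ≤ ρ x y := fun x y => by
    refine (abs_max_sub_max_le_max _ _ _ _).trans ?_
    rw [sub_self, abs_zero]
    refine max_le (hnonneg x y) (abs_le.2 ⟨?_, ?_⟩)
    · linarith [htriangle x₀ y x, hsymm x y]
    · linarith [htriangle x₀ x y]
  have hfp : ∀ x, 0 ≤ f x ^ p := fun x => Real.rpow_nonneg (hf x) p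
  have hρsum : ∀ x, Summable (fun y => b x y * ρ x y ^ 2) ∧ ∑' y, b x y * ρ x y ^ 2 ≤ m x :=
    fun x => summable_and_tsum_le_of_tsum_ofReal_le
      (fun y => mul_nonneg (hb_nonneg x y) (sq_nonneg _)) (hm x).le (hintr x)
  obtain ⟨hG, hGle⟩ := summable_prod_and_tsum_le_of_marginal_le (w := fun x y => b x y * ρ x y ^ 2)
    (u := fun x => f x ^ p) (m := m) (M := 1)
    (fun x y => mul_nonneg (hb_nonneg x y) (sq_nonneg _)) (fun x => (hρsum x).1)
    (fun x => by simpa using (hρsum x).2) hfp hflp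
  obtain ⟨K, hK⟩ := hD x₀ R
  have hφdeg : ∀ x, ∑' y, b x y * φ x ^ 2 ≤ (R ^ 2 * |K|) * m x := fun x => by
    rw [tsum_mul_right]
    by_cases hx : ρ x₀ x ≤ R
    · have h1 : ∑' y, b x y ≤ |K| * m x := by
        have := (hK x hx).trans (le_abs_self K)
        rwa [Deg, one_div, inv_mul_le_iff₀ (hm x), mul_comm] at this
      have h2 : φ x ^ 2 ≤ R ^ 2 := pow_le_pow_left₀ (hφ0 x) (hφR x) 2
      calc _ ≤ |K| * m x * R ^ 2 := mul_le_mul h1 h2 (sq_nonneg _)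
            (mul_nonneg (abs_nonneg K) (hm x).le)
        _ = _ := by ring
    · have : φ x = 0 := max_eq_left (by linarith)
      rw [this]
      have := (hm x).le
      simp only [ne_eq, OfNat.ofNat_ne_zero, not_false_eq_true, zero_pow, mul_zero]
      positivity
  obtain ⟨hH, -⟩ := summable_prod_and_tsum_le_of_marginal_le (w := fun x y => b x y * φ x ^ 2)
    (u := fun x => f x ^ p) (m := m)
    (fun x y => mul_nonneg (hb_nonneg x y) (sq_nonneg _)) (fun x => (hb_sum x).mul_right _)
    hφdeg hfp hflp
  set G : X × X → ℝ := fun z => b z.1 z.2 * ρ z.1 z.2 ^ 2 * f z.1 ^ p with hGdef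
  set H : X × X → ℝ := fun z => b z.1 z.2 * φ z.1 ^ 2 * f z.1 ^ p with hHdef
  set F : X × X → ℝ :=
    fun z => φ z.1 ^ 2 * f z.1 ^ (p - 1) * (b z.1 z.2 * (f z.1 - f z.2)) with hFdef
  have hGs : Summable fun z : X × X => G z.swap := (Equiv.prodComm X X).summable_iff.2 hG
  have hHs : Summable fun z : X × X => H z.swap := (Equiv.prodComm X X).summable_iff.2 hH
  have hF : Summable F := by
    refine Summable.of_norm_bounded (hH.add ((hHs.mul_left 2).add (hGs.mul_left 2))) ?_
    rintro ⟨x, y⟩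
    simp only [hFdef, hHdef, hGdef, Prod.swap, Real.norm_eq_abs]
    have hq : 0 ≤ f x ^ (p - 1) := Real.rpow_nonneg (hf x) _
    rw [abs_mul, abs_mul (b x y), abs_of_nonneg (hb_nonneg x y),
      abs_of_nonneg (mul_nonneg (sq_nonneg (φ x)) hq), hb_symm y x, hsymm y x]
    have h1 := mul_le_mul_of_nonneg_left (rpow_sub_one_mul_abs_sub_le hp (hf x) (hf y))
      (mul_nonneg (hb_nonneg x y) (sq_nonneg (φ x)))
    have h2 : φ x ^ 2 ≤ 2 * φ y ^ 2 + 2 * ρ x y ^ 2 := by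
      have := sq_le_sq' (abs_le.1 (hφlip x y)).1 (abs_le.1 (hφlip x y)).2
      nlinarith [sq_nonneg (φ x - 2 * φ y)]
    have h3 := mul_le_mul_of_nonneg_left h2 (mul_nonneg (hb_nonneg x y) (hfp y))
    linarith
  have hFs : Summable fun z : X × X => F z.swap := (Equiv.prodComm X X).summable_iff.2 hF
  have hFle : ∑' z, F z ≤ 0 := by
    rw [hF.tsum_prod]
    refine tsum_nonpos fun x => ?_
    simp only [hFdef]
    rw [tsum_mul_left]
    exact mul_nonpos_of_nonneg_of_nonpos
      (mul_nonneg (sq_nonneg _) (Real.rpow_nonneg (hf x) _)) (hsub x)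
  set C := 2 / k + 1 with hC
  have hC0 : 0 ≤ C := by positivity
  set E : X × X → ℝ := fun z => (F z + F z.swap) + C * (G z + G z.swap) with hEdef
  have hE : Summable E := (hF.add hFs).add ((hG.add hGs).mul_left C)
  have hEsymm : ∀ z, E z.swap = E z := fun z => by
    simp only [hEdef, Prod.swap_swap]
    ring
  have hElow : ∀ x y, 0 < f x → f y ≤ f x →
      b x y * (k / 2 * (φ x * (1 - f y / f x)) ^ 2 * f x ^ p) ≤ E (x, y) := by
    intro x y hx hxy
    have h := mul_le_mul_of_nonneg_left
      (cutoff_energy_lower_bound hp hx (hf y) hxy (hφ0 x) (hφlip x y)) (hb_nonneg x y)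
    have h' : 0 ≤ C * (b x y * ρ x y ^ 2 * f y ^ p) :=
      mul_nonneg hC0 (mul_nonneg (mul_nonneg (hb_nonneg x y) (sq_nonneg _)) (hfp y))
    rw [← hkdef, ← hC] at h
    simp only [hEdef, hFdef, hGdef, Prod.swap, hb_symm y x, hsymm y x]
    linarith
  have hE0' : ∀ x y, f y ≤ f x → 0 ≤ E (x, y) := by
    intro x y hxy
    rcases (hf x).eq_or_lt with hx | hx
    · have hy : f y = 0 := le_antisymm (hx ▸ hxy) (hf y)
      have hp0 : p ≠ 0 := by linarith
      simp [hEdef, hFdef, hGdef, ← hx, hy, Real.zero_rpow hp0]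
    · refine le_trans ?_ (hElow x y hx hxy)
      have := hfp x
      have := hb_nonneg x y
      positivity
  have hE0 : ∀ z, 0 ≤ E z := by
    rintro ⟨x, y⟩
    rcases le_total (f y) (f x) with h | h
    · exact hE0' x y h
    · rw [← hEsymm]
      exact hE0' y x h
  have hEle : ∑' z, E z ≤ 2 * C * ∑' x, f x ^ p * m x := by
    have e1 : ∑' z : X × X, F z.swap = ∑' z, F z := (Equiv.prodComm X X).tsum_eq F
    have e2 : ∑' z : X × X, G z.swap = ∑' z, G z := (Equiv.prodComm X X).tsum_eq G
    rw [hEdef, (hF.add hFs).tsum_add ((hG.add hGs).mul_left C), hF.tsum_add hFs, tsum_mul_left,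
      hG.tsum_add hGs, e1, e2]
    have := mul_le_mul_of_nonneg_left hGle hC0
    rw [one_mul] at this
    linarith
  have hφx₀ : φ x₀ = R := by simp [hφ, hrefl, hR]
  have h := hElow x₀ y₀ ((hf y₀).trans_lt hlt) hlt.le
  rw [hφx₀] at h
  exact (h.trans (hE.le_tsum _ fun z _ => hE0 z)).trans hEle


theorem yau_Lp_liouville
    {X : Type*} [Countable X] [Infinite X]
    (m : X → ℝ) (hm : ∀ x, 0 < m x)
    (b : X → X → ℝ) (hb_symm : ∀ x y, b x y = b y x)
    (hb_nonneg : ∀ x y, 0 ≤ b x y) (hb_diag : ∀ x, b x x = 0)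
    (hb_sum : ∀ x, Summable fun y => b x y)
    (c : X → ℝ) (hc : ∀ x, 0 ≤ c x)
    (hconn : ∀ x y : X, Relation.ReflTransGen (fun u v : X => 0 < b u v) x y)
    (ρ : X → X → ℝ)
    (hnonneg : ∀ x y, 0 ≤ ρ x y) (hrefl : ∀ x, ρ x x = 0)
    (hsymm : ∀ x y, ρ x y = ρ y x)
    (htriangle : ∀ x y z, ρ x z ≤ ρ x y + ρ y z)
    -- ρ is intrinsic:
    (hintr : ∀ x, ∑' y, ENNReal.ofReal (b x y * (ρ x y) ^ 2) ≤ ENNReal.ofReal (m x))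
    -- (D): the degree is bounded on balls:
    (hD : ∀ (x : X) (r : ℝ), ∃ K : ℝ, ∀ y, ρ x y ≤ r → Deg m b y ≤ K)
    (p : ℝ) (hp : 1 < p)
    (f : X → ℝ)
    (hfF : ∀ x, Summable fun y => b x y * (f y) ^ 2)
    (hflp : Summable fun x => |f x| ^ p * m x)
    (hfpos : ∀ x, 0 ≤ f x) (hfne : f ≠ 0)
    (hfsub : ∀ x, lap m b c f x ≤ 0) :
    ∃ a : ℝ, ∀ x, f x = a := by
  have hsub : ∀ x, ∑' y, b x y * (f x - f y) ≤ 0 := fun x => by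
    have h := hfsub x
    rw [lap] at h
    have h1 : 0 ≤ c x / m x * f x := mul_nonneg (div_nonneg (hc x) (hm x).le) (hfpos x)
    by_contra! h2
    have := mul_pos (one_div_pos.2 (hm x)) h2
    linarith
  have hflp' : Summable fun x => f x ^ p * m x := by
    simpa only [abs_of_nonneg (hfpos _)] using hflp
  have hle : ∀ x y, 0 < b x y → f x ≤ f y := by
    intro x y hxy
    by_contra! hlt
    have hfx : 0 < f x := (hfpos y).trans_lt hlt
    set a := b x y * (min 1 (p - 1) / 2 * (1 - f y / f x) ^ 2 * f x ^ p) with ha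
    have ha0 : 0 < a := by
      have h1 : 0 < min 1 (p - 1) := lt_min one_pos (by linarith)
      have h2 : 0 < 1 - f y / f x := sub_pos.2 ((div_lt_one hfx).2 hlt)
      have h3 : 0 < f x ^ p := Real.rpow_pos_of_pos hfx p
      positivity
    set S := 2 * (2 / min 1 (p - 1) + 1) * ∑' x, f x ^ p * m x with hS
    have hbound : ∀ R : ℝ, 0 ≤ R → a * R ^ 2 ≤ S := fun R hR => by
      have := edge_energy_le hm hb_symm hb_nonneg hb_sum hnonneg hrefl hsymm htriangle hintr hD hp
        hfpos hflp' hsub hlt hR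
      rw [ha]
      linarith
    have h1 := hbound (|S| / a + 1) (by positivity)
    have h2 : a * (|S| / a + 1) ^ 2 = |S| ^ 2 / a + 2 * |S| + a := by
      field_simp
      ring
    have h3 : 0 ≤ |S| ^ 2 / a := by positivity
    linarith [le_abs_self S, abs_nonneg S]
  have heq : ∀ x y, 0 < b x y → f x = f y := fun x y h =>
    (hle x y h).antisymm (hle y x (hb_symm x y ▸ h))
  obtain ⟨x₀⟩ : Nonempty X := inferInstance
  refine ⟨f x₀, fun x => ?_⟩
  induction hconn x₀ x with
  | refl => rfl
  | tail _ h ih => rw [← heq _ _ h, ih]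

end Stmt10
end

section
/- Let (b,c) be a connected graph over (X,m), ρ an intrinsic metric satisfying condition (D), p ∈ (1,∞) and o ∈ X. Then there exists C > 0 such that for every positive subharmonic function f ∈ ℓ^p(X,m) and all 0 < r < R, the Caccioppoli inequality ∑_{x,y ∈ B_r(o)} b(x,y) (max(f(x),f(y)))^{p−2} (f(x) − f(y))² ≤ (C/(R−r)²) ‖f‖_p^p holds, where summands with f(x) = f(y) are read as 0. -/
/-!
STATEMENT 11: Caccioppoli inequality. There exists `C > 0` such that for every
positive subharmonic `f ∈ ℓ^p(X,m)` and all `0 < r < R`,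
`∑_{x,y ∈ B_r(o)} b(x,y) (max (f x) (f y))^{p-2} (f x - f y)² ≤ (C/(R-r)²) ‖f‖_p^p`.
The left hand side is computed in `[0,∞]`; summands with `f x = f y` vanish since
`(f x - f y)² = 0` and `(0:ℝ) ^ (p-2) = 0` for the real power when `p ≠ 2`.
-/

open scoped ENNReal

namespace Stmt11

/-- The formal Laplacian `𝓛 f (x) = (1/m x) ∑_y b x y (f x - f y) + (c x / m x) f x`. -/
noncomputable def lap {X : Type*} (m : X → ℝ) (b : X → X → ℝ) (c : X → ℝ)
    (f : X → ℝ) (x : X) : ℝ :=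
  (1 / m x) * (∑' y, b x y * (f x - f y)) + (c x / m x) * f x

/-- The weighted vertex degree `Deg(x) = (1/m x) ∑_y b x y`. -/
noncomputable def Deg {X : Type*} (m : X → ℝ) (b : X → X → ℝ) (x : X) : ℝ :=
  (1 / m x) * ∑' y, b x y

/-- The distance ball `B_r(o)`. -/
def ball {X : Type*} (ρ : X → X → ℝ) (o : X) (r : ℝ) : Set X := {y | ρ o y ≤ r}

/-- If the rows of a nonnegative kernel sum to at most `w`, then weighting the rows by `g ≥ 0`
gives a summable function whose sum is at most `∑ w g`. -/
lemma summable_and_tsum_le_of_row_le {X : Type*} {a : X → X → ℝ} {g w : X → ℝ}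
    (ha : ∀ x y, 0 ≤ a x y) (hg : ∀ x, 0 ≤ g x) (hs : ∀ x, Summable (a x))
    (hle : ∀ x, ∑' y, a x y ≤ w x) (hw : Summable fun x => g x * w x) :
    (Summable fun q : X × X => g q.1 * a q.1 q.2) ∧
      ∑' q : X × X, g q.1 * a q.1 q.2 ≤ ∑' x, g x * w x := by
  have hrow : ∀ x, g x * ∑' y, a x y ≤ g x * w x := fun x =>
    mul_le_mul_of_nonneg_left (hle x) (hg x)
  have hrows : Summable fun x => g x * ∑' y, a x y :=
    hw.of_nonneg_of_le (fun x => mul_nonneg (hg x) (tsum_nonneg (ha x))) hrow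
  have hsum : Summable fun q : X × X => g q.1 * a q.1 q.2 := by
    refine (summable_prod_of_nonneg fun q => mul_nonneg (hg _) (ha _ _)).2
      ⟨fun x => (hs x).mul_left (g x), ?_⟩
    simpa only [tsum_mul_left] using hrows
  refine ⟨hsum, ?_⟩
  rw [hsum.tsum_prod]
  simp only [tsum_mul_left]
  exact hrows.tsum_le_tsum hrow hw

lemma rpow_sub_one_mul_self {p s : ℝ} (hp : 1 < p) (hs : 0 ≤ s) : s ^ (p - 1) * s = s ^ p := by
  rcases hs.eq_or_lt with rfl | h
  · simp [Real.zero_rpow (by linarith : p ≠ 0)]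
  · rw [← Real.rpow_add_one h.ne', sub_add_cancel]

lemma rpow_sub_one_mul_le {p s t : ℝ} (hp : 1 < p) (hs : 0 ≤ s) (ht : 0 ≤ t) :
    s ^ (p - 1) * t ≤ s ^ p + t ^ p := by
  rcases le_total t s with h | h
  · have := mul_le_mul_of_nonneg_left h (Real.rpow_nonneg hs (p - 1))
    rw [rpow_sub_one_mul_self hp hs] at this
    linarith [Real.rpow_nonneg ht p]
  · have := mul_le_mul_of_nonneg_right
      (Real.rpow_le_rpow hs h (by linarith : 0 ≤ p - 1)) ht
    rw [rpow_sub_one_mul_self hp ht] at this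
    linarith [Real.rpow_nonneg hs p]

lemma one_sub_rpow_ge {q u : ℝ} (hq : 0 < q) (hu : 0 ≤ u) (hu1 : u ≤ 1) :
    min 1 q * (1 - u) ≤ 1 - u ^ q := by
  rcases le_total 1 q with h | h
  · rw [min_eq_left h]
    linarith [Real.rpow_le_self_of_le_one hu hu1 h]
  · rw [min_eq_right h]
    have := rpow_one_add_le_one_add_mul_self (s := u - 1) (by linarith) hq.le h
    rw [add_sub_cancel] at this
    linarith

/-- A one-sided comparison of `s ^ (p - 1) - t ^ (p - 1)` with its linearization at `s`. -/
lemma rpow_sub_rpow_ge {p s t : ℝ} (hp : 1 < p) (hs : 0 < s) (ht : 0 ≤ t) (hts : t ≤ s) :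
    min 1 (p - 1) * (s ^ (p - 2) * (s - t)) ≤ s ^ (p - 1) - t ^ (p - 1) := by
  have h := mul_le_mul_of_nonneg_left
    (one_sub_rpow_ge (sub_pos.2 hp) (div_nonneg ht hs.le) ((div_le_one hs).2 hts))
    (Real.rpow_nonneg hs.le (p - 1))
  have h1 : s ^ (p - 1) * (t / s) ^ (p - 1) = t ^ (p - 1) := by
    rw [Real.div_rpow ht hs.le]
    field_simp [(Real.rpow_pos_of_pos hs (p - 1)).ne']
  have h2 : s ^ (p - 1) = s ^ (p - 2) * s := by
    rw [← Real.rpow_add_one hs.ne']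
    ring_nf
  have h3 : s ^ (p - 1) * (1 - t / s) = s ^ (p - 2) * (s - t) := by
    rw [h2]
    field_simp
  calc min 1 (p - 1) * (s ^ (p - 2) * (s - t))
      = s ^ (p - 1) * (min 1 (p - 1) * (1 - t / s)) := by rw [← h3]; ring
    _ ≤ s ^ (p - 1) * (1 - (t / s) ^ (p - 1)) := h
    _ = s ^ (p - 1) - t ^ (p - 1) := by rw [mul_sub, mul_one, h1]

lemma caccioppoli_pointwise_of_le {p k s t α β : ℝ} (hp : 1 < p) (hk : k = min 1 (p - 1))
    (ht : 0 ≤ t) (hts : t < s) :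
    k / 2 * (β ^ 2 * (s ^ (p - 2) * (s - t) ^ 2)) ≤
      (α ^ 2 * s ^ (p - 1) - β ^ 2 * t ^ (p - 1)) * (s - t)
        + (1 + 2 / k) * ((α - β) ^ 2 * s ^ p) := by
  have hs : 0 < s := ht.trans_lt hts
  have hk0 : 0 < k := hk ▸ lt_min one_pos (sub_pos.2 hp)
  have hst : 0 < s - t := sub_pos.2 hts
  set w := s ^ (p - 2) with hw
  have hw0 : 0 < w := Real.rpow_pos_of_pos hs _
  have h1 : s ^ (p - 1) = w * s := by
    rw [hw, ← Real.rpow_add_one hs.ne']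
    ring_nf
  have h2 : s ^ p = w * s * s := by rw [← h1, rpow_sub_one_mul_self hp hs.le]
  have hmono : β ^ 2 * (s - t) * (k * (w * (s - t))) ≤
      β ^ 2 * (s - t) * (w * s - t ^ (p - 1)) := by
    refine mul_le_mul_of_nonneg_left ?_ (by positivity)
    rw [hk, ← h1]
    exact rpow_sub_rpow_ge hp hs ht hts.le
  have hyoung : 0 ≤ k / 2 * w * (β * (s - t) + 2 / k * (α - β) * s) ^ 2 := by positivity
  have hexp : k / 2 * w * (β * (s - t) + 2 / k * (α - β) * s) ^ 2 =
      k / 2 * w * (β * (s - t)) ^ 2 + 2 * w * β * (s - t) * (α - β) * s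
        + 2 / k * ((α - β) ^ 2 * (w * s * s)) := by
    field_simp
    ring
  have hsq : 0 ≤ (α - β) ^ 2 * (w * s * (s - t)) := by positivity
  have hsq' : 0 ≤ (α - β) ^ 2 * (w * s * s) := by positivity
  rw [h1, h2]
  rw [hexp] at hyoung
  nlinarith [hmono, hyoung, hsq, hsq']

lemma caccioppoli_pointwise {p k s t α β : ℝ} (hp : 1 < p) (hk : k = min 1 (p - 1))
    (hs : 0 ≤ s) (ht : 0 ≤ t) (hα : 0 ≤ α) (hβ : 0 ≤ β) :
    k / 2 * (min α β ^ 2 * (max s t ^ (p - 2) * (s - t) ^ 2)) ≤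
      (α ^ 2 * s ^ (p - 1) - β ^ 2 * t ^ (p - 1)) * (s - t)
        + (1 + 2 / k) * ((α - β) ^ 2 * (s ^ p + t ^ p)) := by
  have hk0 : 0 < k := hk ▸ lt_min one_pos (sub_pos.2 hp)
  have hsp := Real.rpow_nonneg hs p
  have htp := Real.rpow_nonneg ht p
  have hmin : 0 ≤ min α β := le_min hα hβ
  rcases lt_trichotomy t s with h | rfl | h
  · have key := caccioppoli_pointwise_of_le (α := α) (β := β) hp hk ht h
    have hp2 := Real.rpow_nonneg hs (p - 2)
    rw [max_eq_left h.le]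
    have h1 : min α β ^ 2 ≤ β ^ 2 := pow_le_pow_left₀ hmin (min_le_right _ _) 2
    calc _ ≤ k / 2 * (β ^ 2 * (s ^ (p - 2) * (s - t) ^ 2)) := by gcongr
      _ ≤ _ := key
      _ ≤ _ := by gcongr; linarith
  · simp only [sub_self, mul_zero, zero_add, ne_eq, OfNat.ofNat_ne_zero, not_false_eq_true,
      zero_pow]
    positivity
  · have key := caccioppoli_pointwise_of_le (α := β) (β := α) hp hk hs h
    have hp2 := Real.rpow_nonneg ht (p - 2)
    rw [max_eq_right h.le]
    have h1 : min α β ^ 2 ≤ α ^ 2 := pow_le_pow_left₀ hmin (min_le_left _ _) 2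
    calc _ ≤ k / 2 * (α ^ 2 * (t ^ (p - 2) * (t - s) ^ 2)) := by
          rw [← neg_sub t s, neg_sq]; gcongr
      _ ≤ _ := key
      _ ≤ (β ^ 2 * t ^ (p - 1) - α ^ 2 * s ^ (p - 1)) * (t - s)
          + (1 + 2 / k) * ((β - α) ^ 2 * (s ^ p + t ^ p)) := by gcongr; linarith
      _ = _ := by ring

/-- Caccioppoli inequality for a general cutoff function `η`, whose energy density is at most `L`
and on whose support the degree is bounded. -/
lemma caccioppoli_of_cutoff {X : Type*} {m : X → ℝ} {b : X → X → ℝ} {p k K L : ℝ}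
    {f η : X → ℝ} (hb_symm : ∀ x y, b x y = b y x) (hb_nonneg : ∀ x y, 0 ≤ b x y)
    (hb_sum : ∀ x, Summable (b x)) (hp : 1 < p) (hk : k = min 1 (p - 1))
    (hη : ∀ x, 0 ≤ η x) (hdeg : ∀ x, η x ^ 2 * ∑' y, b x y ≤ K * m x)
    (hE : ∀ x, Summable fun y => b x y * (η x - η y) ^ 2)
    (hEle : ∀ x, ∑' y, b x y * (η x - η y) ^ 2 ≤ L * m x)
    (hf : ∀ x, 0 ≤ f x) (hfp : Summable fun x => f x ^ p * m x)
    (hsub : ∀ x, ∑' y, b x y * (f x - f y) ≤ 0) :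
    let T : X × X → ℝ := fun q => b q.1 q.2 *
      (min (η q.1) (η q.2) ^ 2 * (max (f q.1) (f q.2) ^ (p - 2) * (f q.1 - f q.2) ^ 2))
    Summable T ∧ ∑' q, T q ≤ 4 * (1 + 2 / k) / k * (L * ∑' x, f x ^ p * m x) := by
  intro T
  have hk0 : 0 < k := hk ▸ lt_min one_pos (sub_pos.2 hp)
  have hfp0 : ∀ x, 0 ≤ f x ^ p := fun x => Real.rpow_nonneg (hf x) p
  have hswap {u : X × X → ℝ} (hu : Summable u) : Summable fun q : X × X => u q.swap :=
    (Equiv.prodComm X X).summable_iff.2 hu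
  have hswap_tsum (u : X × X → ℝ) : ∑' q : X × X, u q.swap = ∑' q, u q :=
    (Equiv.prodComm X X).tsum_eq u
  obtain ⟨hA, -⟩ := summable_and_tsum_le_of_row_le (a := fun x y => η x ^ 2 * b x y)
    (g := fun x => f x ^ p) (w := fun x => K * m x)
    (fun x y => mul_nonneg (sq_nonneg _) (hb_nonneg x y)) hfp0
    (fun x => (hb_sum x).mul_left _) (fun x => by rw [tsum_mul_left]; exact hdeg x)
    ((hfp.mul_left K).congr fun x => by ring)
  obtain ⟨hD, hDle⟩ := summable_and_tsum_le_of_row_le (a := fun x y => b x y * (η x - η y) ^ 2)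
    (g := fun x => f x ^ p) (w := fun x => L * m x)
    (fun x y => mul_nonneg (hb_nonneg x y) (sq_nonneg _)) hfp0 hE hEle
    ((hfp.mul_left L).congr fun x => by ring)
  set A : X × X → ℝ := fun q => f q.1 ^ p * (η q.1 ^ 2 * b q.1 q.2) with hAdef
  set D : X × X → ℝ := fun q => f q.1 ^ p * (b q.1 q.2 * (η q.1 - η q.2) ^ 2) with hDdef
  have hDle' : ∑' q, D q ≤ L * ∑' x, f x ^ p * m x := by
    rw [← tsum_mul_left]
    exact hDle.trans_eq (tsum_congr fun x => by ring)
  set G : X × X → ℝ := fun q =>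
    η q.1 ^ 2 * f q.1 ^ (p - 1) * (b q.1 q.2 * (f q.1 - f q.2)) with hGdef
  have hG : Summable G := by
    refine Summable.of_norm_bounded
      (((hA.mul_left 2).add ((hswap hA).mul_left 2)).add ((hswap hD).mul_left 2)) ?_
    rintro ⟨x, y⟩
    have hx := Real.rpow_nonneg (hf x) (p - 1)
    have hbxy := hb_nonneg x y
    have h1 : f x ^ (p - 1) * |f x - f y| ≤ 2 * f x ^ p + f y ^ p := by
      have habs : |f x - f y| ≤ f x + f y :=
        abs_le.2 ⟨by linarith [hf x, hf y], by linarith [hf x, hf y]⟩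
      calc f x ^ (p - 1) * |f x - f y| ≤ f x ^ (p - 1) * (f x + f y) := by gcongr
        _ = f x ^ p + f x ^ (p - 1) * f y := by rw [mul_add, rpow_sub_one_mul_self hp (hf x)]
        _ ≤ _ := by linarith [rpow_sub_one_mul_le hp (hf x) (hf y)]
    have h2 : η x ^ 2 ≤ 2 * η y ^ 2 + 2 * (η y - η x) ^ 2 := by
      nlinarith [sq_nonneg (2 * η y - η x)]
    calc ‖G (x, y)‖ = η x ^ 2 * b x y * (f x ^ (p - 1) * |f x - f y|) := by
          rw [Real.norm_eq_abs, hGdef]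
          simp only [abs_mul, abs_of_nonneg hx, abs_of_nonneg hbxy, abs_of_nonneg (sq_nonneg (η x))]
          ring
      _ ≤ η x ^ 2 * b x y * (2 * f x ^ p + f y ^ p) := by gcongr
      _ = 2 * A (x, y) + f y ^ p * b x y * η x ^ 2 := by simp only [hAdef]; ring
      _ ≤ 2 * A (x, y) + f y ^ p * b x y * (2 * η y ^ 2 + 2 * (η y - η x) ^ 2) := by
          have := hfp0 y
          gcongr
      _ = 2 * A (x, y) + 2 * A (y, x) + 2 * D (y, x) := by
          simp only [hAdef, hDdef, hb_symm y x]; ring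
  have hGle : ∑' q, G q ≤ 0 := by
    rw [hG.tsum_prod]
    refine tsum_nonpos fun x => ?_
    simp only [hGdef, tsum_mul_left]
    exact mul_nonpos_of_nonneg_of_nonpos
      (mul_nonneg (sq_nonneg _) (Real.rpow_nonneg (hf x) _)) (hsub x)
  have hT0 : ∀ q, 0 ≤ k / 2 * T q := fun q => mul_nonneg (by positivity)
    (mul_nonneg (hb_nonneg _ _) (mul_nonneg (sq_nonneg _)
      (mul_nonneg (Real.rpow_nonneg (le_max_of_le_left (hf _)) _) (sq_nonneg _))))
  have hTle : ∀ q, k / 2 * T q ≤ (G q + G q.swap) + (1 + 2 / k) * (D q + D q.swap) := by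
    rintro ⟨x, y⟩
    have := mul_le_mul_of_nonneg_left
      (caccioppoli_pointwise hp hk (hf x) (hf y) (hη x) (hη y)) (hb_nonneg x y)
    simp only [T, hGdef, hDdef, Prod.swap_prod_mk, hb_symm y x]
    linarith
  have hGs := hG.add (hswap hG)
  have hDs := (hD.add (hswap hD)).mul_left (1 + 2 / k)
  have hTs : Summable fun q => k / 2 * T q := (hGs.add hDs).of_nonneg_of_le hT0 hTle
  have hle := hTs.tsum_le_tsum hTle (hGs.add hDs)
  rw [hGs.tsum_add hDs, hG.tsum_add (hswap hG), tsum_mul_left, tsum_mul_left,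
    hD.tsum_add (hswap hD), hswap_tsum, hswap_tsum] at hle
  refine ⟨(summable_mul_left_iff (by positivity)).1 hTs, ?_⟩
  have hbound : k / 2 * ∑' q, T q ≤ (1 + 2 / k) * (2 * (L * ∑' x, f x ^ p * m x)) := by
    have : (1 + 2 / k) * (∑' q, D q + ∑' q, D q) ≤
        (1 + 2 / k) * (2 * (L * ∑' x, f x ^ p * m x)) := by
      gcongr
      linarith
    linarith
  calc ∑' q, T q = 2 / k * (k / 2 * ∑' q, T q) := by field_simp
    _ ≤ 2 / k * ((1 + 2 / k) * (2 * (L * ∑' x, f x ^ p * m x))) := by gcongr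
    _ = _ := by ring

/-- A summation bound in `[0,∞]` gives summability and the same bound in `ℝ`. -/
lemma summable_and_tsum_le_of_ofReal {X : Type*} {g : X → ℝ} {B : ℝ} (hg : ∀ x, 0 ≤ g x)
    (hB : 0 ≤ B) (h : ∑' x, ENNReal.ofReal (g x) ≤ ENNReal.ofReal B) :
    Summable g ∧ ∑' x, g x ≤ B := by
  have hs : Summable g := by
    have := ENNReal.summable_toReal (ne_top_of_le_ne_top ENNReal.ofReal_ne_top h)
    simpa only [ENNReal.toReal_ofReal (hg _)] using this
  rw [← ENNReal.ofReal_tsum_of_nonneg hg hs] at h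
  exact ⟨hs, (ENNReal.ofReal_le_ofReal_iff hB).1 h⟩

/-- The cutoff function equal to `1` on the ball of radius `r` and to `0` off that of radius `R`. -/
noncomputable def cutoff {X : Type*} (ρ : X → X → ℝ) (o : X) (r R : ℝ) (x : X) : ℝ :=
  max 0 (min 1 ((R - ρ o x) / (R - r)))

lemma cutoff_nonneg {X : Type*} (ρ : X → X → ℝ) (o : X) (r R : ℝ) (x : X) :
    0 ≤ cutoff ρ o r R x := le_max_left _ _

lemma cutoff_le_one {X : Type*} (ρ : X → X → ℝ) (o : X) (r R : ℝ) (x : X) :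
    cutoff ρ o r R x ≤ 1 := max_le zero_le_one (min_le_left _ _)

lemma cutoff_eq_one {X : Type*} {ρ : X → X → ℝ} {o : X} {r R : ℝ} (hrR : r < R) {x : X}
    (hx : ρ o x ≤ r) : cutoff ρ o r R x = 1 := by
  have : 1 ≤ (R - ρ o x) / (R - r) := (one_le_div (sub_pos.2 hrR)).2 (by linarith)
  rw [cutoff, min_eq_left this, max_eq_right zero_le_one]

lemma cutoff_eq_zero {X : Type*} {ρ : X → X → ℝ} {o : X} {r R : ℝ} (hrR : r < R) {x : X}
    (hx : R ≤ ρ o x) : cutoff ρ o r R x = 0 :=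
  max_eq_left ((min_le_right _ _).trans
    (div_nonpos_of_nonpos_of_nonneg (by linarith) (sub_pos.2 hrR).le))

lemma sq_cutoff_sub_le {X : Type*} {ρ : X → X → ℝ} {o : X} {r R : ℝ} (hrR : r < R)
    (hsymm : ∀ x y, ρ x y = ρ y x) (htriangle : ∀ x y z, ρ x z ≤ ρ x y + ρ y z) (x y : X) :
    (cutoff ρ o r R x - cutoff ρ o r R y) ^ 2 ≤ 1 / (R - r) ^ 2 * ρ x y ^ 2 := by
  have hpos : 0 < R - r := sub_pos.2 hrR
  have hclamp (u v : ℝ) : |max 0 (min 1 u) - max 0 (min 1 v)| ≤ |u - v| := by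
    have h1 := abs_max_sub_max_le_abs (min 1 u) (min 1 v) 0
    have h2 := abs_min_sub_min_le_max 1 u 1 v
    rw [max_comm (min 1 u), max_comm (min 1 v)] at h1
    rw [sub_self, abs_zero, max_eq_right (abs_nonneg _)] at h2
    exact h1.trans h2
  have hρ : |ρ o y - ρ o x| ≤ ρ x y :=
    abs_le.2 ⟨by linarith [htriangle o y x, hsymm x y], by linarith [htriangle o x y]⟩
  have h : |cutoff ρ o r R x - cutoff ρ o r R y| ≤ ρ x y / (R - r) := by
    refine (hclamp _ _).trans ?_
    rw [← sub_div, abs_div, abs_of_pos hpos, sub_sub_sub_cancel_left]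
    gcongr
  calc _ = |cutoff ρ o r R x - cutoff ρ o r R y| ^ 2 := (sq_abs _).symm
    _ ≤ (ρ x y / (R - r)) ^ 2 := by gcongr
    _ = _ := by rw [div_pow]; ring

theorem caccioppoli_inequality
    {X : Type*} [Countable X] [Infinite X]
    (m : X → ℝ) (hm : ∀ x, 0 < m x)
    (b : X → X → ℝ) (hb_symm : ∀ x y, b x y = b y x)
    (hb_nonneg : ∀ x y, 0 ≤ b x y) (hb_diag : ∀ x, b x x = 0)
    (hb_sum : ∀ x, Summable fun y => b x y)
    (c : X → ℝ) (hc : ∀ x, 0 ≤ c x)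
    (hconn : ∀ x y : X, Relation.ReflTransGen (fun u v : X => 0 < b u v) x y)
    (ρ : X → X → ℝ)
    (hnonneg : ∀ x y, 0 ≤ ρ x y) (hrefl : ∀ x, ρ x x = 0)
    (hsymm : ∀ x y, ρ x y = ρ y x)
    (htriangle : ∀ x y z, ρ x z ≤ ρ x y + ρ y z)
    -- ρ is intrinsic:
    (hintr : ∀ x, ∑' y, ENNReal.ofReal (b x y * (ρ x y) ^ 2) ≤ ENNReal.ofReal (m x))
    -- (D): the degree is bounded on balls:
    (hD : ∀ (x : X) (r : ℝ), ∃ K : ℝ, ∀ y, ρ x y ≤ r → Deg m b y ≤ K)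
    (p : ℝ) (hp : 1 < p) (o : X) :
    ∃ C : ℝ, 0 < C ∧
      ∀ f : X → ℝ,
        (∀ x, Summable fun y => b x y * (f y) ^ 2) →
        (Summable fun x => |f x| ^ p * m x) →
        (∀ x, 0 ≤ f x) → f ≠ 0 →
        (∀ x, lap m b c f x ≤ 0) →
        ∀ r R : ℝ, 0 < r → r < R →
          ∑' q : (ball ρ o r ×ˢ ball ρ o r : Set (X × X)),
              ENNReal.ofReal (b q.1.1 q.1.2 *
                (max (f q.1.1) (f q.1.2)) ^ (p - 2) * (f q.1.1 - f q.1.2) ^ 2)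
            ≤ ENNReal.ofReal (C / (R - r) ^ 2 * ∑' x, |f x| ^ p * m x) := by
  set k := min 1 (p - 1) with hk
  have hk0 : 0 < k := lt_min one_pos (sub_pos.2 hp)
  refine ⟨4 * (1 + 2 / k) / k, by positivity, ?_⟩
  intro f _ hfp hf _ hlap r R _ hrR
  simp only [abs_of_nonneg (hf _)] at hfp ⊢
  obtain ⟨K, hK⟩ := hD o R
  set η := cutoff ρ o r R with hη
  have hρsum := fun x => summable_and_tsum_le_of_ofReal
    (fun y => mul_nonneg (hb_nonneg x y) (sq_nonneg (ρ x y))) (hm x).le (hintr x)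
  have hEbound : ∀ x y, b x y * (η x - η y) ^ 2 ≤ 1 / (R - r) ^ 2 * (b x y * ρ x y ^ 2) := by
    intro x y
    have := mul_le_mul_of_nonneg_left
      (sq_cutoff_sub_le (o := o) hrR hsymm htriangle x y) (hb_nonneg x y)
    exact this.trans_eq (by ring)
  have hE : ∀ x, Summable fun y => b x y * (η x - η y) ^ 2 := fun x =>
    ((hρsum x).1.mul_left _).of_nonneg_of_le
      (fun y => mul_nonneg (hb_nonneg x y) (sq_nonneg _)) (hEbound x)
  have hEle : ∀ x, ∑' y, b x y * (η x - η y) ^ 2 ≤ 1 / (R - r) ^ 2 * m x := fun x =>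
    calc _ ≤ ∑' y, 1 / (R - r) ^ 2 * (b x y * ρ x y ^ 2) :=
          (hE x).tsum_le_tsum (hEbound x) ((hρsum x).1.mul_left _)
      _ ≤ _ := by
          rw [tsum_mul_left]
          exact mul_le_mul_of_nonneg_left (hρsum x).2 (by positivity)
  have hdeg : ∀ x, η x ^ 2 * ∑' y, b x y ≤ |K| * m x := by
    intro x
    rcases le_total (ρ o x) R with h | h
    · have h1 : ∑' y, b x y ≤ K * m x := by
        have := hK x h
        rwa [Deg, one_div_mul_eq_div, div_le_iff₀ (hm x)] at this
      calc η x ^ 2 * ∑' y, b x y ≤ 1 * ∑' y, b x y := by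
            gcongr
            · exact tsum_nonneg (hb_nonneg x)
            · exact pow_le_one₀ (cutoff_nonneg ..) (cutoff_le_one ..)
        _ ≤ |K| * m x := by
            rw [one_mul]
            exact h1.trans (mul_le_mul_of_nonneg_right (le_abs_self K) (hm x).le)
    · rw [hη, cutoff_eq_zero hrR h, zero_pow two_ne_zero, zero_mul]
      exact mul_nonneg (abs_nonneg K) (hm x).le
  have hsub : ∀ x, ∑' y, b x y * (f x - f y) ≤ 0 := by
    intro x
    have h1 := hlap x
    have h2 : 0 ≤ c x / m x * f x := mul_nonneg (div_nonneg (hc x) (hm x).le) (hf x)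
    have h3 : (1 / m x) * ∑' y, b x y * (f x - f y) ≤ 0 := by
      rw [lap] at h1
      linarith
    exact nonpos_of_mul_nonpos_right h3 (one_div_pos.2 (hm x))
  obtain ⟨hT, hTle⟩ := caccioppoli_of_cutoff hb_symm hb_nonneg hb_sum hp hk
    (cutoff_nonneg ρ o r R) hdeg hE hEle hf hfp hsub
  have hT0 : ∀ q : X × X, 0 ≤ b q.1 q.2 * (min (η q.1) (η q.2) ^ 2 *
      (max (f q.1) (f q.2) ^ (p - 2) * (f q.1 - f q.2) ^ 2)) := fun q =>
    mul_nonneg (hb_nonneg _ _) (mul_nonneg (sq_nonneg _)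
      (mul_nonneg (Real.rpow_nonneg (le_max_of_le_left (hf _)) _) (sq_nonneg _)))
  calc _ = ∑' q : (ball ρ o r ×ˢ ball ρ o r : Set (X × X)),
        ENNReal.ofReal (b q.1.1 q.1.2 * (min (η q.1.1) (η q.1.2) ^ 2 *
          (max (f q.1.1) (f q.1.2) ^ (p - 2) * (f q.1.1 - f q.1.2) ^ 2))) := by
        refine tsum_congr fun q => ?_
        rw [hη, cutoff_eq_one hrR q.2.1, cutoff_eq_one hrR q.2.2, min_self, one_pow, one_mul,
          mul_assoc]
    _ ≤ ∑' q : X × X, ENNReal.ofReal (b q.1 q.2 * (min (η q.1) (η q.2) ^ 2 *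
          (max (f q.1) (f q.2) ^ (p - 2) * (f q.1 - f q.2) ^ 2))) :=
        ENNReal.tsum_comp_le_tsum_of_injective Subtype.val_injective _
    _ = ENNReal.ofReal _ := (ENNReal.ofReal_tsum_of_nonneg hT0 hT).symm
    _ ≤ _ := ENNReal.ofReal_le_ofReal (hTle.trans_eq (by ring))

end Stmt11
end

section
/- Let b be a connected graph over (X,m) and ρ an intrinsic metric satisfying conditions (D) and (J). Let p ∈ (1,∞), x ∈ X, and let f be a positive subharmonic function such that ∫_{r₀}^{∞} r / ‖f 1_{B_r(x)}‖_p^p dr = ∞ for every r₀ > 0 (with the convention r/0 := +∞, where 1_B denotes the characteristic function of B). Then f is constant. -/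
/-!
STATEMENT 12: Karp's theorem for graphs. Under conditions (D) and (J), a positive
subharmonic function `f` with `∫_{r₀}^∞ r / ‖f 1_{B_r(x)}‖_p^p dr = ∞` for every
`r₀ > 0` is constant. The quantity `‖f 1_{B_r(x)}‖_p^p = ∑_{y ∈ B_r(x)} |f y|^p m(y)`
is computed in `[0,∞]`, and the quotient is taken in `[0,∞]` (so `r/0 = +∞` for `r > 0`).
-/

open scoped ENNReal

namespace Stmt12

/-- The formal Laplacian (with `c ≡ 0`). -/
noncomputable def lap {X : Type*} (m : X → ℝ) (b : X → X → ℝ)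
    (f : X → ℝ) (x : X) : ℝ :=
  (1 / m x) * (∑' y, b x y * (f x - f y))

/-- The weighted vertex degree `Deg(x) = (1/m x) ∑_y b x y`. -/
noncomputable def Deg {X : Type*} (m : X → ℝ) (b : X → X → ℝ) (x : X) : ℝ :=
  (1 / m x) * ∑' y, b x y

/-- `‖f 1_{B_r(x)}‖_p^p ∈ [0,∞]`. -/
noncomputable def normPBall {X : Type*} (m : X → ℝ) (ρ : X → X → ℝ) (p : ℝ)
    (f : X → ℝ) (x : X) (r : ℝ) : ℝ≥0∞ :=
  ∑' y : ({z | ρ x z ≤ r} : Set X), ENNReal.ofReal (|f y| ^ p * m y)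

lemma mul_sq_mul_max_rpow_le {p a c : ℝ} (hp : 1 < p) (ha : 0 ≤ a) (hc : 0 ≤ c) :
    min 1 (p - 1) * ((a - c) ^ 2 * max a c ^ (p - 2)) ≤
      (a - c) * (a ^ (p - 1) - c ^ (p - 1)) := by
  wlog hca : c ≤ a generalizing a c
  · have := this hc ha (le_of_not_ge hca)
    rw [max_comm] at this
    nlinarith [this]
  rw [max_eq_left hca]
  rcases ha.eq_or_lt with rfl | ha
  · obtain rfl : c = 0 := le_antisymm hca hc
    simp
  have hsplit : a ^ (p - 1) = a * a ^ (p - 2) := by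
    rw [mul_comm, ← Real.rpow_add_one ha.ne']; ring_nf
  have hA : 0 < a ^ (p - 2) := Real.rpow_pos_of_pos ha _
  suffices h : min 1 (p - 1) * ((a - c) * a ^ (p - 2)) ≤ a ^ (p - 1) - c ^ (p - 1) by
    nlinarith [mul_le_mul_of_nonneg_left h (sub_nonneg.2 hca)]
  rcases le_total 2 p with h2 | h2
  · have h1 : c ^ (p - 1) ≤ c * a ^ (p - 2) := by
      rcases hc.eq_or_lt with rfl | hc'
      · rw [Real.zero_rpow (by linarith)]; simp
      · have : c ^ (p - 1) = c * c ^ (p - 2) := by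
          rw [mul_comm, ← Real.rpow_add_one hc'.ne']; ring_nf
        rw [this]
        exact mul_le_mul_of_nonneg_left (Real.rpow_le_rpow hc hca (by linarith)) hc
    have h3 : min 1 (p - 1) * ((a - c) * a ^ (p - 2)) ≤ 1 * ((a - c) * a ^ (p - 2)) :=
      mul_le_mul_of_nonneg_right (min_le_left _ _) (mul_nonneg (sub_nonneg.2 hca) hA.le)
    rw [hsplit]; linarith
  · have hB := rpow_one_add_le_one_add_mul_self (s := c / a - 1)
      (by have := div_nonneg hc ha.le; linarith) (p := p - 1) (by linarith) (by linarith)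
    rw [add_sub_cancel, Real.div_rpow hc ha.le, div_le_iff₀ (Real.rpow_pos_of_pos ha _)] at hB
    have h3 : min 1 (p - 1) * ((a - c) * a ^ (p - 2)) ≤ (p - 1) * ((a - c) * a ^ (p - 2)) :=
      mul_le_mul_of_nonneg_right (min_le_right _ _) (mul_nonneg (sub_nonneg.2 hca) hA.le)
    have h4 : (1 + (p - 1) * (c / a - 1)) * a ^ (p - 1) =
        a ^ (p - 1) - (p - 1) * ((a - c) * a ^ (p - 2)) := by
      rw [hsplit]; field_simp; ring
    linarith

lemma sub_mul_rpow_weighted_ge {p a c φ ψ t D : ℝ} (hp : 1 < p) (ha : 0 ≤ a) (hc : 0 ≤ c)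
    (hφ : 0 ≤ φ) (hψ : 0 ≤ ψ) (ht : 0 ≤ t) (hD : 0 ≤ D)
    (hD' : φ ≠ ψ → D = (a - c) ^ 2 * max a c ^ (p - 2) * (φ ^ 2 + ψ ^ 2)) :
    t * (min 1 (p - 1) / 2) * ((a - c) ^ 2 * max a c ^ (p - 2) * (φ ^ 2 + ψ ^ 2)) ≤
      t * ((a - c) * (φ ^ 2 * a ^ (p - 1) - ψ ^ 2 * c ^ (p - 1))) + t ^ 2 * D +
        1 / 2 * ((φ - ψ) ^ 2 * max a c ^ p) := by
  wlog hca : c ≤ a generalizing a c φ ψ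
  · have := this hc ha hψ hφ (fun h => by rw [hD' h.symm, max_comm]; ring) (le_of_not_ge hca)
    rw [max_comm] at this
    nlinarith [this]
  have hG := mul_sq_mul_max_rpow_le hp ha hc
  rw [max_eq_left hca] at *
  rcases ha.eq_or_lt with rfl | ha
  · obtain rfl : c = 0 := le_antisymm hca hc
    rw [Real.zero_rpow (by linarith : p ≠ 0)]
    simp
    positivity
  have h1 := mul_le_mul_of_nonneg_left hG
    (by positivity : 0 ≤ t * ((φ ^ 2 + ψ ^ 2) / 2))
  suffices h : -(t * ((φ ^ 2 - ψ ^ 2) * (a - c) * ((a ^ (p - 1) + c ^ (p - 1)) / 2))) ≤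
      t ^ 2 * D + 1 / 2 * ((φ - ψ) ^ 2 * a ^ p) by
    linear_combination h1 + h
  rcases eq_or_ne φ ψ with rfl | hne
  · simp
    positivity
  rw [hD' hne]
  set u := (a - c) * a ^ ((p - 2) / 2) with hu
  set v := a ^ (p / 2) with hv
  have hu2 : (a - c) ^ 2 * a ^ (p - 2) = u ^ 2 := by
    rw [hu, mul_pow, ← Real.rpow_natCast (a ^ _), ← Real.rpow_mul ha.le]; norm_num
  have hv2 : a ^ p = v ^ 2 := by
    rw [hv, ← Real.rpow_natCast (a ^ _), ← Real.rpow_mul ha.le]; norm_num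
  have huv : (a - c) * a ^ (p - 1) = u * v := by
    rw [hu, hv, mul_assoc, ← Real.rpow_add ha]; ring_nf
  have hcp : c ^ (p - 1) ≤ a ^ (p - 1) := Real.rpow_le_rpow hc hca (by linarith)
  have hcp0 : 0 ≤ c ^ (p - 1) := Real.rpow_nonneg hc _
  have h0 : 0 ≤ (a - c) * ((a ^ (p - 1) + c ^ (p - 1)) / 2) := by
    have := Real.rpow_nonneg ha.le (p - 1)
    exact mul_nonneg (sub_nonneg.2 hca) (by linarith)
  have h2 : (a - c) * ((a ^ (p - 1) + c ^ (p - 1)) / 2) ≤ u * v := by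
    rw [← huv]; exact mul_le_mul_of_nonneg_left (by linarith) (sub_nonneg.2 hca)
  have h3 : -(t * ((φ ^ 2 - ψ ^ 2) * (a - c) * ((a ^ (p - 1) + c ^ (p - 1)) / 2))) ≤
      t * (|φ - ψ| * (φ + ψ)) * (u * v) := by
    have h4 : -(φ ^ 2 - ψ ^ 2) ≤ |φ - ψ| * (φ + ψ) := by
      nlinarith [neg_abs_le (φ - ψ), add_nonneg hφ hψ]
    have h5 : 0 ≤ |φ - ψ| * (φ + ψ) := by positivity
    calc _ = t * (-(φ ^ 2 - ψ ^ 2) * ((a - c) * ((a ^ (p - 1) + c ^ (p - 1)) / 2))) := by ring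
      _ ≤ t * (|φ - ψ| * (φ + ψ) * (u * v)) := by
        refine mul_le_mul_of_nonneg_left ?_ ht
        exact (mul_le_mul_of_nonneg_right h4 h0).trans (mul_le_mul_of_nonneg_left h2 h5)
      _ = _ := by ring
  refine h3.trans ?_
  rw [hu2, hv2, ← sq_abs (φ - ψ)]
  nlinarith [sq_nonneg (t * u * (φ + ψ) - |φ - ψ| * v), mul_nonneg (sq_nonneg (t * u)) (sq_nonneg (φ - ψ))]

lemma max_rpow_le_add {p a c : ℝ} (ha : 0 ≤ a) (hc : 0 ≤ c) :
    max a c ^ p ≤ a ^ p + c ^ p := by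
  rcases le_total a c with h | h
  · rw [max_eq_right h]; linarith [Real.rpow_nonneg ha p]
  · rw [max_eq_left h]; linarith [Real.rpow_nonneg hc p]

lemma sq_mul_max_rpow_le {p a c : ℝ} (hp : 1 < p) (ha : 0 ≤ a) (hc : 0 ≤ c) :
    (a - c) ^ 2 * max a c ^ (p - 2) ≤ a ^ p + c ^ p := by
  refine le_trans ?_ (max_rpow_le_add ha hc)
  rcases (le_max_of_le_left ha : 0 ≤ max a c).eq_or_lt with h | h
  · have h1 : a = 0 := le_antisymm (h ▸ le_max_left a c) ha
    have h2 : c = 0 := le_antisymm (h ▸ le_max_right a c) hc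
    subst h1 h2
    simp [Real.zero_rpow (by linarith : p ≠ 0)]
  · have h1 : max a c ^ p = max a c ^ 2 * max a c ^ (p - 2) := by
      rw [← Real.rpow_natCast, ← Real.rpow_add h]; norm_num
    rw [h1]
    refine mul_le_mul_of_nonneg_right ?_ (Real.rpow_nonneg h.le _)
    rw [← sq_abs]
    refine pow_le_pow_left₀ (abs_nonneg _) ?_ 2
    rw [abs_le]
    constructor <;> linarith [le_max_left a c, le_max_right a c]

lemma abs_sub_mul_rpow_le {p a c : ℝ} (hp : 1 < p) (ha : 0 ≤ a) (hc : 0 ≤ c) :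
    |a - c| * a ^ (p - 1) ≤ a ^ p + c ^ p := by
  refine le_trans ?_ (max_rpow_le_add ha hc)
  rcases (le_max_of_le_left ha : 0 ≤ max a c).eq_or_lt with h | h
  · have h1 : a = 0 := le_antisymm (h ▸ le_max_left a c) ha
    subst h1
    rw [← h]
    simp [Real.zero_rpow (by linarith : p ≠ 0), Real.zero_rpow (by linarith : p - 1 ≠ 0)]
  · have h1 : max a c ^ p = max a c * max a c ^ (p - 1) := by
      rw [mul_comm, ← Real.rpow_add_one h.ne']; ring_nf
    rw [h1]
    refine mul_le_mul ?_ (Real.rpow_le_rpow ha (le_max_left _ _) (by linarith))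
      (Real.rpow_nonneg ha _) h.le
    rw [abs_le]
    constructor <;> linarith [le_max_left a c, le_max_right a c]

lemma summable_prod_mul_and_tsum_le {X : Type*} {β : X → X → ℝ} {g C : X → ℝ}
    (hβ : ∀ x y, 0 ≤ β x y) (hg : ∀ x, 0 ≤ g x) (hβs : ∀ x, Summable (β x))
    (hC : ∀ x, g x ≠ 0 → ∑' y, β x y ≤ C x) (hs : Summable fun x => C x * g x) :
    Summable (fun z : X × X => β z.1 z.2 * g z.1) ∧
      ∑' z : X × X, β z.1 z.2 * g z.1 ≤ ∑' x, C x * g x := by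
  have hle : ∀ x, ∑' y, β x y * g x ≤ C x * g x := fun x => by
    rw [tsum_mul_right]
    by_cases h : g x = 0
    · simp [h]
    · exact mul_le_mul_of_nonneg_right (hC x h) (hg x)
  have h0 : ∀ x, 0 ≤ ∑' y, β x y * g x := fun x => tsum_nonneg fun y => mul_nonneg (hβ _ _) (hg _)
  have hsum : Summable fun x => ∑' y, β x y * g x := hs.of_nonneg_of_le h0 hle
  have hS : Summable (fun z : X × X => β z.1 z.2 * g z.1) := by
    refine (summable_prod_of_nonneg (f := fun z : X × X => β z.1 z.2 * g z.1)
      (fun z => mul_nonneg (hβ z.1 z.2) (hg z.1))).2 ⟨fun x => (hβs x).mul_right (g x), hsum⟩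
  exact ⟨hS, hS.tsum_prod.trans_le (hsum.tsum_le_tsum hle hs)⟩

/-- The nonlinear energy density of `f` along the edge `z`. -/
noncomputable def energyDensity {X : Type*} (b : X → X → ℝ) (p : ℝ) (f : X → ℝ) (z : X × X) : ℝ :=
  b z.1 z.2 * ((f z.1 - f z.2) ^ 2 * max (f z.1) (f z.2) ^ (p - 2))

/-- The nonlinear energy of `f` on the edges with both ends in `U`. -/
noncomputable def energyOn {X : Type*} (b : X → X → ℝ) (p : ℝ) (f : X → ℝ) (U : Set X) : ℝ :=
  ∑' z : X × X, (U ×ˢ U).indicator (energyDensity b p f) z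

lemma energyDensity_nonneg {X : Type*} {b : X → X → ℝ} (hb : ∀ x y, 0 ≤ b x y) {p : ℝ}
    {f : X → ℝ} (hf : ∀ x, 0 ≤ f x) (z : X × X) : 0 ≤ energyDensity b p f z :=
  mul_nonneg (hb _ _) (mul_nonneg (sq_nonneg _)
    (Real.rpow_nonneg (le_max_of_le_left (hf _)) _))

lemma summable_energyDensity_indicator {X : Type*} {b : X → X → ℝ}
    (hsymm : ∀ x y, b x y = b y x) (hb : ∀ x y, 0 ≤ b x y) {p : ℝ} (hp : 1 < p)
    {f : X → ℝ} (hf : ∀ x, 0 ≤ f x) {U : Set X}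
    (hS : Summable fun z : X × X => b z.1 z.2 * U.indicator (fun y => f y ^ p) z.1) :
    Summable ((U ×ˢ U).indicator (energyDensity b p f)) := by
  have hS' : Summable fun z : X × X => b z.1 z.2 * U.indicator (fun y => f y ^ p) z.2 := by
    refine ((Equiv.prodComm X X).summable_iff.2 hS).congr fun z => ?_
    simp [hsymm z.2 z.1]
  refine (hS.add hS').of_nonneg_of_le
    (fun z => Set.indicator_nonneg (fun z _ => energyDensity_nonneg hb hf z) z) fun z => ?_
  by_cases hz : z ∈ U ×ˢ U
  · rw [Set.indicator_of_mem hz, Set.indicator_of_mem hz.1, Set.indicator_of_mem hz.2, ← mul_add]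
    exact mul_le_mul_of_nonneg_left (sq_mul_max_rpow_le hp (hf _) (hf _)) (hb _ _)
  · rw [Set.indicator_of_notMem hz]
    have : ∀ y, 0 ≤ U.indicator (fun y => f y ^ p) y :=
      fun y => Set.indicator_nonneg (fun y _ => Real.rpow_nonneg (hf y) _) y
    exact add_nonneg (mul_nonneg (hb _ _) (this _)) (mul_nonneg (hb _ _) (this _))

/-- A Caccioppoli-type inequality for a cutoff `φ` equal to `1` on `N`, all of whose edges
lie in `U`. -/
lemma exists_sq_le_of_cutoff {X : Type*} {b : X → X → ℝ}
    (hsymm : ∀ x y, b x y = b y x) (hb : ∀ x y, 0 ≤ b x y) {p : ℝ} (hp : 1 < p)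
    {f : X → ℝ} (hf : ∀ x, 0 ≤ f x) (hsub : ∀ x, ∑' y, b x y * (f x - f y) ≤ 0)
    {φ : X → ℝ} (hφ0 : ∀ x, 0 ≤ φ x) (hφ1 : ∀ x, φ x ≤ 1) {N U : Set X}
    (hN : ∀ x ∈ N, φ x = 1) (hU : ∀ x y, 0 < b x y → φ x ≠ 0 → x ∈ U ∧ y ∈ U)
    (hS : Summable fun z : X × X => b z.1 z.2 * U.indicator (fun y => f y ^ p) z.1)
    {L V : ℝ}
    {β : X → X → ℝ} (hβsymm : ∀ x y, β x y = β y x)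
    (hβ : ∀ x y, b x y * (φ x - φ y) ^ 2 ≤ L * β x y) (hL : 0 ≤ L) (hβ0 : ∀ x y, 0 ≤ β x y)
    (hSβ : Summable fun z : X × X => β z.1 z.2 * U.indicator (fun y => f y ^ p) z.1)
    (hV : ∑' z : X × X, β z.1 z.2 * U.indicator (fun y => f y ^ p) z.1 ≤ V) :
    ∃ J, 2 * energyOn b p f N ≤ J ∧ J ≤ 2 * energyOn b p f U ∧
      (min 1 (p - 1) / 2 * J) ^ 2 ≤ 4 * (J - 2 * energyOn b p f N) * (L * V) := by
  set F : X → ℝ := U.indicator (fun y => f y ^ p) with hF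
  have hF0 : ∀ y, 0 ≤ F y :=
    fun y => Set.indicator_nonneg (fun y _ => Real.rpow_nonneg (hf y) _) y
  have hU' : ∀ z : X × X, b z.1 z.2 ≠ 0 → (φ z.1 ≠ 0 ∨ φ z.2 ≠ 0) → z ∈ U ×ˢ U := by
    intro z hz h
    have hpos := (hb z.1 z.2).lt_of_ne' hz
    rcases h with h | h
    · exact hU _ _ hpos h
    · exact (hU _ _ (hsymm z.1 z.2 ▸ hpos) h).symm
  have hEU := summable_energyDensity_indicator hsymm hb hp hf hS
  have hE0 := energyDensity_nonneg hb (p := p) hf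
  let j : X × X → ℝ := fun z => energyDensity b p f z * (φ z.1 ^ 2 + φ z.2 ^ 2)
  have hj0 : ∀ z, 0 ≤ j z := fun z => mul_nonneg (hE0 z) (by positivity)
  have hjU : ∀ z, j z ≤ 2 * (U ×ˢ U).indicator (energyDensity b p f) z := by
    intro z
    by_cases hz : z ∈ U ×ˢ U
    · rw [Set.indicator_of_mem hz, mul_comm 2]
      refine mul_le_mul_of_nonneg_left ?_ (hE0 z)
      nlinarith [hφ0 z.1, hφ0 z.2, hφ1 z.1, hφ1 z.2]
    · rw [Set.indicator_of_notMem hz, mul_zero]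
      by_cases hbz : b z.1 z.2 = 0
      · simp [j, energyDensity, hbz]
      · have := mt (hU' z hbz) hz
        push Not at this
        simp [j, this.1, this.2]
  have hjS : Summable j := (hEU.mul_left 2).of_nonneg_of_le hj0 hjU
  have hjN : ∀ z, 2 * (N ×ˢ N).indicator (energyDensity b p f) z ≤ j z := by
    intro z
    by_cases hz : z ∈ N ×ˢ N
    · rw [Set.indicator_of_mem hz]
      simp only [j, hN _ hz.1, hN _ hz.2]
      linarith
    · rw [Set.indicator_of_notMem hz, mul_zero]
      exact hj0 z
  have hNS : Summable ((N ×ˢ N).indicator (energyDensity b p f)) :=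
    hjS.of_nonneg_of_le (fun z => Set.indicator_nonneg (fun z _ => hE0 z) z) fun z => by
      have := hjN z
      have h0 := Set.indicator_nonneg (s := N ×ˢ N) (fun z _ => hE0 z) z
      linarith
  let h : X × X → ℝ := fun z =>
    b z.1 z.2 * (f z.1 - f z.2) * (φ z.1 ^ 2 * f z.1 ^ (p - 1))
  have hSswap : Summable fun z : X × X => b z.1 z.2 * F z.2 := by
    refine ((Equiv.prodComm X X).summable_iff.2 hS).congr fun z => ?_
    simp [hsymm z.2 z.1]
  have hhS : Summable h := by
    refine (hS.add hSswap).of_norm_bounded fun z => ?_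
    have hn : 0 ≤ b z.1 z.2 * F z.1 + b z.1 z.2 * F z.2 :=
      add_nonneg (mul_nonneg (hb _ _) (hF0 _)) (mul_nonneg (hb _ _) (hF0 _))
    by_cases hbz : b z.1 z.2 = 0
    · simp [h, hbz]
    by_cases hφz : φ z.1 = 0
    · simpa [h, hφz] using hn
    have hz := hU' z hbz (Or.inl hφz)
    rw [hF, Set.indicator_of_mem hz.1, Set.indicator_of_mem hz.2, ← mul_add, Real.norm_eq_abs]
    have h1 := Real.rpow_nonneg (hf z.1) (p - 1)
    have h2 : φ z.1 ^ 2 ≤ 1 := pow_le_one₀ (hφ0 _) (hφ1 _)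
    simp only [h]
    rw [abs_mul, abs_mul, abs_of_nonneg (hb _ _), abs_of_nonneg (mul_nonneg (sq_nonneg _) h1),
      mul_assoc]
    refine mul_le_mul_of_nonneg_left ?_ (hb _ _)
    refine le_trans ?_ (abs_sub_mul_rpow_le hp (hf z.1) (hf z.2))
    exact mul_le_mul_of_nonneg_left (mul_le_of_le_one_left h1 h2) (abs_nonneg _)
  have hh0 : ∑' z, h z ≤ 0 := by
    rw [hhS.tsum_prod]
    refine tsum_nonpos fun x => ?_
    simp only [h]
    rw [tsum_mul_right]
    exact mul_nonpos_of_nonpos_of_nonneg (hsub x)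
      (mul_nonneg (sq_nonneg _) (Real.rpow_nonneg (hf _) _))
  have hhswapS : Summable fun z : X × X => h z.swap := (Equiv.prodComm X X).summable_iff.2 hhS
  have hhswap : ∑' z : X × X, h z.swap = ∑' z, h z := (Equiv.prodComm X X).tsum_eq h
  let v : X × X → ℝ := fun z => β z.1 z.2 * F z.1
  have hvswapS : Summable fun z : X × X => v z.swap := (Equiv.prodComm X X).summable_iff.2 hSβ
  have hvswap : ∑' z : X × X, v z.swap = ∑' z, v z := (Equiv.prodComm X X).tsum_eq v
  have hvS : Summable v := hSβ
  classical
  have key : ∀ t : ℝ, 0 ≤ t → ∀ z, t * (min 1 (p - 1) / 2) * j z ≤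
      t * (h z + h z.swap) + t ^ 2 * (j z - 2 * (N ×ˢ N).indicator (energyDensity b p f) z) +
        L / 2 * (v z + v z.swap) := by
    intro t ht z
    have hv0 : 0 ≤ v z + v z.swap :=
      add_nonneg (mul_nonneg (hβ0 _ _) (hF0 _)) (mul_nonneg (hβ0 _ _) (hF0 _))
    have hG0 : 0 ≤ (f z.1 - f z.2) ^ 2 * max (f z.1) (f z.2) ^ (p - 2) :=
      mul_nonneg (sq_nonneg _) (Real.rpow_nonneg (le_max_of_le_left (hf _)) _)
    have hpt := sub_mul_rpow_weighted_ge (φ := φ z.1) (ψ := φ z.2)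
      (D := if z ∈ N ×ˢ N then 0 else
        (f z.1 - f z.2) ^ 2 * max (f z.1) (f z.2) ^ (p - 2) * (φ z.1 ^ 2 + φ z.2 ^ 2))
      hp (hf z.1) (hf z.2) (hφ0 _) (hφ0 _) ht
      (by split_ifs; exacts [le_rfl, mul_nonneg hG0 (by positivity)])
      (fun hne => if_neg fun hz => hne (by rw [hN _ hz.1, hN _ hz.2]))
    have hmul := mul_le_mul_of_nonneg_left hpt (hb z.1 z.2)
    have hhz : h z + h z.swap = b z.1 z.2 * ((f z.1 - f z.2) *
        (φ z.1 ^ 2 * f z.1 ^ (p - 1) - φ z.2 ^ 2 * f z.2 ^ (p - 1))) := by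
      simp only [h, Prod.fst_swap, Prod.snd_swap, hsymm z.2 z.1]; ring
    have hDz : b z.1 z.2 * (if z ∈ N ×ˢ N then 0 else
        (f z.1 - f z.2) ^ 2 * max (f z.1) (f z.2) ^ (p - 2) * (φ z.1 ^ 2 + φ z.2 ^ 2)) =
        j z - 2 * (N ×ˢ N).indicator (energyDensity b p f) z := by
      split_ifs with hz
      · rw [Set.indicator_of_mem hz]
        simp only [j, hN _ hz.1, hN _ hz.2]; ring
      · rw [Set.indicator_of_notMem hz]
        simp only [j, energyDensity]; ring
    have hvz : b z.1 z.2 * ((φ z.1 - φ z.2) ^ 2 * max (f z.1) (f z.2) ^ p) ≤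
        L * (v z + v z.swap) := by
      by_cases hbz : b z.1 z.2 = 0
      · rw [hbz, zero_mul]; exact mul_nonneg hL hv0
      by_cases hφz : φ z.1 ≠ 0 ∨ φ z.2 ≠ 0
      · have hz := hU' z hbz hφz
        have hM := max_rpow_le_add (p := p) (hf z.1) (hf z.2)
        have hvv : v z + v z.swap = β z.1 z.2 * (f z.1 ^ p + f z.2 ^ p) := by
          simp only [v, hF, Prod.fst_swap, Prod.snd_swap, hβsymm z.2 z.1,
            Set.indicator_of_mem hz.1, Set.indicator_of_mem hz.2]
          ring
        rw [hvv, ← mul_assoc, ← mul_assoc]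
        exact mul_le_mul (hβ _ _) hM (Real.rpow_nonneg (le_max_of_le_left (hf _)) _)
          (mul_nonneg hL (hβ0 _ _))
      · push Not at hφz
        rw [hφz.1, hφz.2]
        simpa using mul_nonneg hL hv0
    rw [hhz, ← hDz]
    simp only [j, energyDensity]
    linear_combination hmul + 1 / 2 * hvz
  have hsum : ∀ t : ℝ, 0 ≤ t → t * (min 1 (p - 1) / 2) * ∑' z, j z ≤
      t ^ 2 * (∑' z, j z - 2 * energyOn b p f N) + L * V := by
    intro t ht
    have h1 := (hhS.add hhswapS).mul_left t
    have h2 := (hjS.sub (hNS.mul_left 2)).mul_left (t ^ 2)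
    have h3 := (hvS.add hvswapS).mul_left (L / 2)
    have h4 := (hjS.mul_left (t * (min 1 (p - 1) / 2))).tsum_le_tsum (key t ht)
      ((h1.add h2).add h3)
    rw [(h1.add h2).tsum_add h3, h1.tsum_add h2, tsum_mul_left, tsum_mul_left, tsum_mul_left,
      tsum_mul_left, hhS.tsum_add hhswapS, hjS.tsum_sub (hNS.mul_left 2), tsum_mul_left,
      hvS.tsum_add hvswapS, hhswap, hvswap] at h4
    have h5 := mul_nonneg ht (neg_nonneg.2 hh0)
    have h6 := mul_le_mul_of_nonneg_left hV hL
    unfold energyOn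
    linear_combination h4 + 2 * h5 + h6
  have hJN : 2 * energyOn b p f N ≤ ∑' z, j z := by
    rw [energyOn, ← tsum_mul_left]
    exact (hNS.mul_left 2).tsum_le_tsum hjN hjS
  refine ⟨∑' z, j z, hJN, ?_, ?_⟩
  · rw [energyOn, ← tsum_mul_left]
    exact hjS.tsum_le_tsum hjU (hEU.mul_left 2)
  · have hα : 0 ≤ min 1 (p - 1) / 2 := div_nonneg (le_min zero_le_one (by linarith)) zero_le_two
    have hJ0 : 0 ≤ ∑' z, j z := tsum_nonneg hj0
    have hLV : 0 ≤ L * V := by simpa using hsum 0 le_rfl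
    have hd := discrim_le_zero (a := ∑' z, j z - 2 * energyOn b p f N)
      (b := -(min 1 (p - 1) / 2 * ∑' z, j z)) (c := L * V) fun t => by
        rcases le_total 0 t with ht | ht
        · linear_combination hsum t ht
        · have h1 := mul_nonneg (sub_nonneg.2 hJN) (mul_self_nonneg t)
          have h2 := mul_nonneg (mul_nonneg hα hJ0) (neg_nonneg.2 ht)
          linear_combination h1 + h2 + hLV
    rw [discrim] at hd
    linear_combination hd

lemma div_le_inv_sub_inv {Q J E k K : ℝ} (hQ : 0 < Q) (hQJ : 2 * Q ≤ J) (hJE : J ≤ 2 * E)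
    (hK : 0 < K) (h : (k / 2 * J) ^ 2 ≤ 4 * (J - 2 * Q) * K) :
    k ^ 2 / (8 * K) ≤ Q⁻¹ - E⁻¹ := by
  have hJ : 0 < J := by linarith
  have h1 : E⁻¹ ≤ 2 / J := by
    rw [← one_div, div_le_div_iff₀ (by linarith) hJ]; linarith
  have h2 : k ^ 2 / (8 * K) ≤ Q⁻¹ - 2 / J := by
    have h3 : Q⁻¹ - 2 / J = (J - 2 * Q) / (Q * J) := by field_simp
    rw [h3, div_le_div_iff₀ (by positivity) (by positivity)]
    have h4 : k ^ 2 * (Q * J) ≤ k ^ 2 * (J * J / 2) :=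
      mul_le_mul_of_nonneg_left (by nlinarith) (sq_nonneg k)
    linarith
  linarith

lemma summable_and_tsum_le_of_tsum_ofReal_le {X : Type*} {g : X → ℝ} (hg : ∀ y, 0 ≤ g y) {c : ℝ}
    (hc : 0 ≤ c) (h : ∑' y, ENNReal.ofReal (g y) ≤ ENNReal.ofReal c) :
    Summable g ∧ ∑' y, g y ≤ c := by
  have hs : Summable g :=
    (ENNReal.summable_toReal (ne_top_of_le_ne_top ENNReal.ofReal_ne_top h)).congr
      fun y => ENNReal.toReal_ofReal (hg y)
  rw [← ENNReal.ofReal_tsum_of_nonneg hg hs, ENNReal.ofReal_le_ofReal_iff hc] at h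
  exact ⟨hs, h⟩

lemma normPBall_eq_tsum {X : Type*} (m : X → ℝ) (ρ : X → X → ℝ) (p : ℝ)
    {f : X → ℝ} (hf : ∀ y, 0 ≤ f y) (x : X) (r : ℝ) :
    normPBall m ρ p f x r =
      ∑' y, ENNReal.ofReal (m y * {z | ρ x z ≤ r}.indicator (fun y => f y ^ p) y) := by
  rw [normPBall, tsum_subtype {z | ρ x z ≤ r} fun y => ENNReal.ofReal (|f y| ^ p * m y)]
  refine tsum_congr fun y => ?_
  by_cases hy : y ∈ {z | ρ x z ≤ r}
  · rw [Set.indicator_of_mem hy, Set.indicator_of_mem hy, abs_of_nonneg (hf y), mul_comm]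
  · rw [Set.indicator_of_notMem hy, Set.indicator_of_notMem hy]; simp

lemma normPBall_mono {X : Type*} (m : X → ℝ) (ρ : X → X → ℝ) (p : ℝ) (f : X → ℝ) (x : X) :
    Monotone (normPBall m ρ p f x) := by
  intro r r' hr
  exact ENNReal.tsum_mono_subtype (fun y => ENNReal.ofReal (|f y| ^ p * m y))
    fun z (hz : ρ x z ≤ r) => hz.trans hr

/-- One dyadic step: doubling the radius of a ball decreases the inverse energy by a definite
amount. -/
lemma inv_energyOn_ball_sub_ge {X : Type*} {m : X → ℝ} (hm : ∀ x, 0 < m x)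
    {b : X → X → ℝ} (hb_symm : ∀ x y, b x y = b y x) (hb_nonneg : ∀ x y, 0 ≤ b x y)
    (hb_sum : ∀ x, Summable fun y => b x y) {ρ : X → X → ℝ}
    (hsymm : ∀ x y, ρ x y = ρ y x) (htriangle : ∀ x y z, ρ x z ≤ ρ x y + ρ y z)
    (hintr : ∀ x, ∑' y, ENNReal.ofReal (b x y * (ρ x y) ^ 2) ≤ ENNReal.ofReal (m x))
    (hD : ∀ (x : X) (r : ℝ), ∃ K : ℝ, ∀ y, ρ x y ≤ r → Deg m b y ≤ K)
    {s : ℝ} (hs : ∀ x y, 0 < b x y → ρ x y ≤ s) {p : ℝ} (hp : 1 < p) (o : X)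
    {f : X → ℝ} (hf : ∀ z, 0 ≤ f z) (hsub : ∀ z, lap m b f z ≤ 0)
    {r : ℝ} (hr : 0 < r) (hsr : 2 * s ≤ r) {V : ℝ} (hV : 0 < V)
    (hVr : normPBall m ρ p f o (2 * r) = ENNReal.ofReal V) {u v : X} (hu : ρ o u ≤ r)
    (hv : ρ o v ≤ r) (huv : 0 < energyDensity b p f (u, v)) :
    0 < energyOn b p f {z | ρ o z ≤ r} ∧ 0 < energyOn b p f {z | ρ o z ≤ 2 * r} ∧
    (min 1 (p - 1)) ^ 2 / 32 * (r ^ 2 / V) ≤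
      (energyOn b p f {z | ρ o z ≤ r})⁻¹ - (energyOn b p f {z | ρ o z ≤ 2 * r})⁻¹ := by
  set U := {z | ρ o z ≤ 2 * r}
  set N := {z | ρ o z ≤ r}
  have hNU : N ⊆ U := fun z (hz : ρ o z ≤ r) => show ρ o z ≤ 2 * r by linarith
  set F : X → ℝ := U.indicator (fun y => f y ^ p)
  have hF0 : ∀ y, 0 ≤ F y :=
    fun y => Set.indicator_nonneg (fun y _ => Real.rpow_nonneg (hf y) _) y
  rw [normPBall_eq_tsum m ρ p hf] at hVr
  obtain ⟨hms, hmV⟩ := summable_and_tsum_le_of_tsum_ofReal_le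
    (fun y => mul_nonneg (hm y).le (hF0 y)) hV.le hVr.le
  obtain ⟨K, hK⟩ := hD o (2 * r)
  have hS := (summable_prod_mul_and_tsum_le (β := b) (g := F) (C := fun y => K * m y)
    hb_nonneg hF0 hb_sum (fun y hy => by
      have := hK y (Set.mem_of_indicator_ne_zero (s := U) hy)
      rwa [Deg, one_div, inv_mul_le_iff₀ (hm y), mul_comm] at this)
    ((hms.mul_left K).congr fun y => by ring)).1
  have hβ := fun y => summable_and_tsum_le_of_tsum_ofReal_le
    (fun z => mul_nonneg (hb_nonneg y z) (sq_nonneg (ρ y z))) (hm y).le (hintr y)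
  obtain ⟨hSβ, hVβ⟩ := summable_prod_mul_and_tsum_le (β := fun y z => b y z * ρ y z ^ 2)
    (g := F) (C := m) (fun y z => mul_nonneg (hb_nonneg y z) (sq_nonneg _)) hF0
    (fun y => (hβ y).1) (fun y _ => (hβ y).2) hms
  have hEpos : ∀ W ⊆ U, (u, v) ∈ W ×ˢ W → 0 < energyOn b p f W := by
    intro W hW hmem
    have hE0 := energyDensity_nonneg hb_nonneg (p := p) hf
    have hsum : Summable ((W ×ˢ W).indicator (energyDensity b p f)) := by
      have h1 := (summable_energyDensity_indicator hb_symm hb_nonneg hp hf hS).indicator (W ×ˢ W)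
      rwa [Set.indicator_indicator, Set.inter_eq_left.2 (Set.prod_mono hW hW)] at h1
    refine hsum.tsum_pos (fun z => Set.indicator_nonneg (fun z _ => hE0 z) z) (u, v) ?_
    rwa [Set.indicator_of_mem hmem]
  have hQ : 0 < energyOn b p f N := hEpos N hNU ⟨hu, hv⟩
  refine ⟨hQ, hEpos U subset_rfl ⟨hNU hu, hNU hv⟩, ?_⟩
  have hlip : ∀ y z, |ρ o y - ρ o z| ≤ ρ y z := fun y z => by
    rw [abs_le]
    constructor
    · linarith [htriangle o y z]
    · linarith [htriangle o z y, hsymm y z]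
  let φ : X → ℝ := fun z => max (min 1 (1 - 2 / r * (ρ o z - r))) 0
  have hφlip : ∀ y z, |φ y - φ z| ≤ 2 / r * ρ y z := fun y z => by
    have h1 : |φ y - φ z| ≤
        |min 1 (1 - 2 / r * (ρ o y - r)) - min 1 (1 - 2 / r * (ρ o z - r))| :=
      abs_max_sub_max_le_abs _ _ _
    have h2 := abs_min_sub_min_le_max 1 (1 - 2 / r * (ρ o y - r)) 1 (1 - 2 / r * (ρ o z - r))
    rw [sub_self, abs_zero, max_eq_right (abs_nonneg _)] at h2
    refine h1.trans (h2.trans ?_)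
    rw [show 1 - 2 / r * (ρ o y - r) - (1 - 2 / r * (ρ o z - r)) =
      -(2 / r * (ρ o y - ρ o z)) by ring, abs_neg, abs_mul, abs_of_pos (by positivity : 0 < 2 / r)]
    exact mul_le_mul_of_nonneg_left (hlip y z) (by positivity)
  obtain ⟨J, hJ1, hJ2, hJ3⟩ := exists_sq_le_of_cutoff (N := N) (φ := φ) hb_symm hb_nonneg hp hf
    (fun z => by
      have h1 := hsub z
      rw [lap, one_div, inv_mul_le_iff₀ (hm z), mul_zero] at h1
      exact h1)
    (fun z => le_max_right _ _) (fun z => max_le (min_le_left _ _) zero_le_one)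
    (fun z (hz : ρ o z ≤ r) => by
      have : 2 / r * (ρ o z - r) ≤ 0 :=
        mul_nonpos_of_nonneg_of_nonpos (by positivity) (by linarith)
      simp only [φ]
      rw [min_eq_left (by linarith), max_eq_left zero_le_one])
    (fun y z hyz hy => by
      have h1 : 0 < 1 - 2 / r * (ρ o y - r) := by
        by_contra! h
        exact hy (max_eq_right ((min_le_right _ _).trans h))
      have h2 : ρ o y - r < r / 2 := by
        have : 2 / r * (ρ o y - r) < 1 := by linarith
        rw [div_mul_eq_mul_div, div_lt_one hr] at this
        linarith
      have h3 := hs y z hyz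
      have h4 := htriangle o y z
      exact ⟨show ρ o y ≤ 2 * r by linarith, show ρ o z ≤ 2 * r by linarith⟩)
    hS (β := fun y z => b y z * ρ y z ^ 2) (L := (2 / r) ^ 2)
    (fun y z => by rw [hb_symm, hsymm])
    (fun y z => by
      have h1 : (φ y - φ z) ^ 2 ≤ (2 / r * ρ y z) ^ 2 := by
        rw [← sq_abs]; exact pow_le_pow_left₀ (abs_nonneg _) (hφlip y z) 2
      calc _ ≤ b y z * (2 / r * ρ y z) ^ 2 := mul_le_mul_of_nonneg_left h1 (hb_nonneg y z)
        _ = _ := by ring)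
    (sq_nonneg _) (fun y z => mul_nonneg (hb_nonneg y z) (sq_nonneg _)) hSβ (hVβ.trans hmV)
  have := div_le_inv_sub_inv hQ hJ1 hJ2 (by positivity) hJ3
  refine le_of_eq_of_le ?_ this
  field_simp
  ring

lemma normPBall_ne_top {X : Type*} {m : X → ℝ} {ρ : X → X → ℝ} {p : ℝ} {f : X → ℝ} {x : X}
    (hgrowth : ∀ r₀ : ℝ, 0 < r₀ →
      ∫⁻ r in Set.Ioi r₀, ENNReal.ofReal r / normPBall m ρ p f x r = ⊤) (r : ℝ) :
    normPBall m ρ p f x r ≠ ⊤ := by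
  intro h
  have h1 : ∫⁻ t in Set.Ioi (max r 1), ENNReal.ofReal t / normPBall m ρ p f x t =
      ∫⁻ t in Set.Ioi (max r 1), 0 := by
    refine MeasureTheory.setLIntegral_congr_fun measurableSet_Ioi fun t ht => ?_
    have h2 : normPBall m ρ p f x t = ⊤ :=
      top_le_iff.1 (h ▸ normPBall_mono m ρ p f x ((le_max_left r 1).trans (le_of_lt ht)))
    simp [h2]
  rw [hgrowth _ (lt_max_of_lt_right one_pos)] at h1
  simp at h1

lemma lintegral_Ioi_div_le_tsum {N : ℝ → ℝ≥0∞} (hN : Monotone N) {R : ℝ} (hR : 0 < R) :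
    ∫⁻ r in Set.Ioi (2 * R), ENNReal.ofReal r / N r ≤
      ∑' n : ℕ, ENNReal.ofReal (8 * (2 ^ n * R) ^ 2) / N (2 * (2 ^ n * R)) := by
  have hcover : Set.Ioi (2 * R) ⊆ ⋃ n : ℕ, Set.Ico (2 * (2 ^ n * R)) (4 * (2 ^ n * R)) := by
    intro r (hr : 2 * R < r)
    obtain ⟨n, hn1, hn2⟩ := exists_nat_pow_near (x := r / (2 * R)) (y := 2)
      ((one_le_div (by positivity)).2 hr.le) one_lt_two
    rw [le_div_iff₀ (by positivity)] at hn1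
    rw [div_lt_iff₀ (by positivity), pow_succ] at hn2
    exact Set.mem_iUnion.2 ⟨n, by linarith, by linarith⟩
  refine (MeasureTheory.lintegral_mono_set hcover).trans
    ((MeasureTheory.lintegral_iUnion_le _ _).trans (ENNReal.tsum_le_tsum fun n => ?_))
  set T := 2 ^ n * R
  have hT : 0 < T := by positivity
  calc ∫⁻ r in Set.Ico (2 * T) (4 * T), ENNReal.ofReal r / N r
      ≤ ∫⁻ _ in Set.Ico (2 * T) (4 * T), ENNReal.ofReal (4 * T) / N (2 * T) :=
        MeasureTheory.setLIntegral_mono' measurableSet_Ico fun r hr =>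
          ENNReal.div_le_div (ENNReal.ofReal_le_ofReal hr.2.le) (hN hr.1)
    _ = ENNReal.ofReal (8 * T ^ 2) / N (2 * T) := by
        rw [MeasureTheory.setLIntegral_const, Real.volume_Ico, ENNReal.div_eq_inv_mul, mul_assoc,
          ← ENNReal.ofReal_mul (by positivity), ← ENNReal.div_eq_inv_mul]
        ring_nf

theorem karp_theorem
    {X : Type*} [Countable X] [Infinite X]
    (m : X → ℝ) (hm : ∀ x, 0 < m x)
    (b : X → X → ℝ) (hb_symm : ∀ x y, b x y = b y x)
    (hb_nonneg : ∀ x y, 0 ≤ b x y) (hb_diag : ∀ x, b x x = 0)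
    (hb_sum : ∀ x, Summable fun y => b x y)
    (hconn : ∀ x y : X, Relation.ReflTransGen (fun u v : X => 0 < b u v) x y)
    (ρ : X → X → ℝ)
    (hnonneg : ∀ x y, 0 ≤ ρ x y) (hrefl : ∀ x, ρ x x = 0)
    (hsymm : ∀ x y, ρ x y = ρ y x)
    (htriangle : ∀ x y z, ρ x z ≤ ρ x y + ρ y z)
    -- ρ is intrinsic:
    (hintr : ∀ x, ∑' y, ENNReal.ofReal (b x y * (ρ x y) ^ 2) ≤ ENNReal.ofReal (m x))
    -- (D): the degree is bounded on balls:
    (hD : ∀ (x : X) (r : ℝ), ∃ K : ℝ, ∀ y, ρ x y ≤ r → Deg m b y ≤ K)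
    -- (J): finite jump size:
    (hJ : ∃ s : ℝ, ∀ x y, 0 < b x y → ρ x y ≤ s)
    (p : ℝ) (hp : 1 < p) (x : X)
    (f : X → ℝ)
    (hfF : ∀ z, Summable fun y => b z y * (f y) ^ 2)
    (hfpos : ∀ z, 0 ≤ f z) (hfne : f ≠ 0)
    (hfsub : ∀ z, lap m b f z ≤ 0)
    (hgrowth : ∀ r₀ : ℝ, 0 < r₀ →
      ∫⁻ r in Set.Ioi r₀, ENNReal.ofReal r / normPBall m ρ p f x r = ⊤) :
    ∃ a : ℝ, ∀ z, f z = a := by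
  obtain ⟨s, hs⟩ := hJ
  have hfin := normPBall_ne_top hgrowth
  have hedge : ∀ u v, 0 < b u v → f u = f v := by
    intro u v huv
    by_contra hne
    obtain ⟨w, hw, hfw⟩ : ∃ w, ρ x w ≤ ρ x u + ρ x v ∧ 0 < f w := by
      rcases lt_or_gt_of_ne hne with h | h
      · exact ⟨v, by linarith [hnonneg x u], (hfpos u).trans_lt h⟩
      · exact ⟨u, by linarith [hnonneg x v], (hfpos v).trans_lt h⟩
    have hdens : 0 < energyDensity b p f (u, v) := by
      refine mul_pos huv (mul_pos (pow_two_pos_of_ne_zero (sub_ne_zero.2 hne))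
        (Real.rpow_pos_of_pos ?_ _))
      rcases lt_or_gt_of_ne hne with h | h
      · exact lt_max_of_lt_right ((hfpos u).trans_lt h)
      · exact lt_max_of_lt_left ((hfpos v).trans_lt h)
    set R := 1 + 2 * |s| + ρ x u + ρ x v
    have hR0 : 0 < R := by linarith [abs_nonneg s, hnonneg x u, hnonneg x v]
    let T : ℕ → ℝ := fun n => 2 ^ n * R
    have hTR : ∀ n, R ≤ T n := fun n => le_mul_of_one_le_left hR0.le (one_le_pow₀ one_le_two)
    have hTsucc : ∀ n, T (n + 1) = 2 * T n := fun n => by simp only [T]; ring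
    let V : ℕ → ℝ := fun n => (normPBall m ρ p f x (2 * T n)).toReal
    have hV : ∀ n, normPBall m ρ p f x (2 * T n) = ENNReal.ofReal (V n) :=
      fun n => (ENNReal.ofReal_toReal (hfin _)).symm
    have hVpos : ∀ n, 0 < V n := fun n => by
      refine ENNReal.toReal_pos (ne_of_gt ?_) (hfin _)
      have hwmem : ρ x w ≤ 2 * T n := by
        linarith [hTR n, abs_nonneg s, hnonneg x u, hnonneg x v]
      refine lt_of_lt_of_le ?_ (ENNReal.le_tsum (⟨w, hwmem⟩ : {z | ρ x z ≤ 2 * T n}))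
      exact ENNReal.ofReal_pos.2 (mul_pos (Real.rpow_pos_of_pos (abs_pos.2 hfw.ne') _) (hm w))
    let E : ℕ → ℝ := fun n => energyOn b p f {z | ρ x z ≤ T n}
    have hstep : ∀ n, 0 < E n ∧ min 1 (p - 1) ^ 2 / 32 * (T n ^ 2 / V n) ≤
        (E n)⁻¹ - (E (n + 1))⁻¹ := fun n => by
      have h := inv_energyOn_ball_sub_ge hm hb_symm hb_nonneg hb_sum hsymm htriangle hintr hD hs
        hp x hfpos hfsub (hR0.trans_le (hTR n))
        (by linarith [hTR n, le_abs_self s, hnonneg x u, hnonneg x v]) (hVpos n) (hV n)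
        (by linarith [hTR n, abs_nonneg s, hnonneg x v] : ρ x u ≤ T n)
        (by linarith [hTR n, abs_nonneg s, hnonneg x u] : ρ x v ≤ T n) hdens
      simp only [E, hTsucc]
      exact ⟨h.1, h.2.2⟩
    set k := min 1 (p - 1) ^ 2 / 32
    have hkpos : 0 < k := by
      have : 0 < min 1 (p - 1) := lt_min one_pos (by linarith)
      positivity
    have hnn : ∀ n, 0 ≤ 8 * T n ^ 2 / V n := fun n => by have := hVpos n; positivity
    have hsum : Summable fun n => 8 * T n ^ 2 / V n := by
      refine summable_of_sum_range_le (c := 8 / k * (E 0)⁻¹) hnn fun n => ?_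
      calc ∑ i ∈ Finset.range n, 8 * T i ^ 2 / V i
          = 8 / k * ∑ i ∈ Finset.range n, k * (T i ^ 2 / V i) := by
            rw [Finset.mul_sum]
            exact Finset.sum_congr rfl fun i _ => by field_simp
        _ ≤ 8 / k * ∑ i ∈ Finset.range n, ((E i)⁻¹ - (E (i + 1))⁻¹) :=
            mul_le_mul_of_nonneg_left (Finset.sum_le_sum fun i _ => (hstep i).2) (by positivity)
        _ ≤ 8 / k * (E 0)⁻¹ := by
            rw [Finset.sum_range_sub' fun i => (E i)⁻¹]
            exact mul_le_mul_of_nonneg_left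
              (sub_le_self _ (inv_nonneg.2 (hstep n).1.le)) (by positivity)
    have hbound := lintegral_Ioi_div_le_tsum (normPBall_mono m ρ p f x) hR0
    rw [hgrowth (2 * R) (by positivity), top_le_iff] at hbound
    refine (ENNReal.ofReal_ne_top (r := ∑' n, 8 * T n ^ 2 / V n)) ?_
    rw [ENNReal.ofReal_tsum_of_nonneg hnn hsum, ← hbound]
    exact tsum_congr fun n => by rw [ENNReal.ofReal_div_of_pos (hVpos n), ← hV n]
  refine ⟨f x, fun z => ?_⟩
  induction hconn x z with
  | refl => rfl
  | tail _ h ih => exact (hedge _ _ h).symm.trans ih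

end Stmt12
end
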